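/- Let c ∈ (0, 1/2) and let n be an integer with 4 ≤ ξ(c) ≤ n. Then φ_4(n,c) = φ_4(c). -/

import Mathlib

/-- The multilinear form `L_r(A, x)` of an `n × n` matrix `A` and a vector `x`. -/
noncomputable def L (n r : ℕ) (A : Fin n → Fin n → ℝ) (x : Fin n → ℝ) : ℝ :=
  ∑ X ∈ Finset.powersetCard r (Finset.univ : Finset (Fin n)),
    (∏ i ∈ X, ∏ j ∈ X.filter (fun j => i < j), A i j) * ∏ i ∈ X, x i

/-- `(A, x) ∈ 𝒮_n(c)`: `A` is symmetric with zero diagonal and entries in `[0,1]`,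
`x` is nonnegative, `L_1(A,x) = 1` and `L_2(A,x) = c`. -/
noncomputable def memS (n : ℕ) (c : ℝ) (A : Fin n → Fin n → ℝ) (x : Fin n → ℝ) : Prop :=
  (∀ i, A i i = 0) ∧ (∀ i j, 0 ≤ A i j) ∧ (∀ i j, A i j ≤ 1) ∧ (∀ i j, A i j = A j i) ∧
    (∀ i, 0 ≤ x i) ∧ L n 1 A x = 1 ∧ L n 2 A x = c

/-- `ξ(c) = ⌈1/(1 - 2c)⌉`. -/
noncomputable def xi (c : ℝ) : ℕ := ⌈1 / (1 - 2 * c)⌉₊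

/-- `φ_r(n, c) = min { L_r(A, x) : r ≤ k ≤ n, (A, x) ∈ 𝒮_k(c) }`. -/
noncomputable def phi (r n : ℕ) (c : ℝ) : ℝ :=
  sInf {v : ℝ | ∃ k, r ≤ k ∧ k ≤ n ∧ ∃ (A : Fin k → Fin k → ℝ) (x : Fin k → ℝ),
    memS k c A x ∧ L k r A x = v}

/-- `√(1 - 2 ξ(c) c / (ξ(c) - 1))`. -/
noncomputable def sqc (c : ℝ) : ℝ :=
  Real.sqrt (1 - 2 * (xi c : ℝ) * c / ((xi c : ℝ) - 1))

/-- The large coordinate `x` of the optimal vector `x_c`. -/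
noncomputable def xval (c : ℝ) : ℝ := 1 / (xi c : ℝ) + (1 / (xi c : ℝ)) * sqc c

/-- The small coordinate `y` of the optimal vector `x_c`. -/
noncomputable def yval (c : ℝ) : ℝ :=
  1 / (xi c : ℝ) - (((xi c : ℝ) - 1) / (xi c : ℝ)) * sqc c

/-- `φ_r(c) = C(s-1, r) x^r + C(s-1, r-1) x^{r-1} y` where `s = ξ(c)`. -/
noncomputable def phiF (r : ℕ) (c : ℝ) : ℝ :=
  ((xi c - 1).choose r : ℝ) * xval c ^ r +
    ((xi c - 1).choose (r - 1) : ℝ) * xval c ^ (r - 1) * yval c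

/-- The clique form of degree `r` of the weighted graph `A` at `y`, defined by recursion on
neighbourhoods: `(r + 1) K_{r+1}(y) = ∑ i, y i * K_r (A i · y)`. -/
noncomputable def cliqueForm {ι : Type*} [Fintype ι] (A : ι → ι → ℝ) : ℕ → (ι → ℝ) → ℝ
  | 0, _ => 1
  | r + 1, y => (∑ i, y i * cliqueForm A r (fun j => A i j * y j)) / (r + 1)

/-- Symmetric matrices with zero diagonal and entries in `[0, 1]`. -/
structure IsWeight {ι : Type*} (A : ι → ι → ℝ) : Prop where
  diag : ∀ i, A i i = 0
  nonneg : ∀ i j, 0 ≤ A i j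
  le_one : ∀ i j, A i j ≤ 1
  symm : ∀ i j, A i j = A j i

section CliqueForm

variable {ι : Type*} [Fintype ι] {A : ι → ι → ℝ}

theorem cliqueForm_succ (A : ι → ι → ℝ) (r : ℕ) (y : ι → ℝ) :
    cliqueForm A (r + 1) y = (∑ i, y i * cliqueForm A r (fun j => A i j * y j)) / (r + 1) := rfl

theorem succ_mul_cliqueForm (A : ι → ι → ℝ) (r : ℕ) (y : ι → ℝ) :
    ((r : ℝ) + 1) * cliqueForm A (r + 1) y = ∑ i, y i * cliqueForm A r (fun j => A i j * y j) := by
  rw [cliqueForm_succ]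
  field_simp

theorem cliqueForm_one (A : ι → ι → ℝ) (y : ι → ℝ) : cliqueForm A 1 y = ∑ i, y i := by
  simp [cliqueForm]

theorem cliqueForm_nonneg (hA : IsWeight A) (r : ℕ) :
    ∀ y : ι → ℝ, (∀ i, 0 ≤ y i) → 0 ≤ cliqueForm A r y := by
  induction r with
  | zero => intro y _; simp [cliqueForm]
  | succ r ih =>
    intro y hy
    rw [cliqueForm_succ]
    exact div_nonneg (Finset.sum_nonneg fun i _ => mul_nonneg (hy i)
      (ih _ fun j => mul_nonneg (hA.nonneg i j) (hy j))) (by positivity)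

theorem cliqueForm_smul (A : ι → ι → ℝ) (r : ℕ) :
    ∀ (c : ℝ) (y : ι → ℝ), cliqueForm A r (fun i => c * y i) = c ^ r * cliqueForm A r y := by
  induction r with
  | zero => intro c y; simp [cliqueForm]
  | succ r ih =>
    intro c y
    rw [cliqueForm_succ, cliqueForm_succ, mul_div_assoc', Finset.mul_sum]
    congr 1
    refine Finset.sum_congr rfl fun i _ => ?_
    have := ih c (fun j => A i j * y j)
    rw [show (fun j => A i j * (c * y j)) = fun j => c * (A i j * y j) from
      funext fun j => by ring, this]
    ring

theorem cliqueForm_scale (A : ι → ι → ℝ) (u : ι → ℝ) (r : ℕ) :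
    ∀ y : ι → ℝ, cliqueForm (fun i j => u i * u j * A i j) (r + 1) y =
      cliqueForm A (r + 1) (fun i => u i ^ r * y i) := by
  induction r with
  | zero => intro y; simp [cliqueForm]
  | succ r ih =>
    intro y
    rw [cliqueForm_succ, cliqueForm_succ A]
    congr 1
    refine Finset.sum_congr rfl fun i _ => ?_
    rw [ih, show (fun j => u j ^ r * (u i * u j * A i j * y j)) =
      fun j => u i * (A i j * (u j ^ (r + 1) * y j)) from funext fun j => by ring,
      cliqueForm_smul]
    ring

theorem continuous_cliqueForm {E : Type*} [TopologicalSpace E] (r : ℕ) :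
    ∀ {A : E → ι → ι → ℝ} {y : E → ι → ℝ}, (∀ i j, Continuous fun p => A p i j) →
      (∀ i, Continuous fun p => y p i) → Continuous fun p => cliqueForm (A p) r (y p) := by
  induction r with
  | zero => intro A y _ _; simpa [cliqueForm] using continuous_const
  | succ r ih =>
    intro A y hA hy
    simp only [cliqueForm_succ]
    exact (continuous_finsetSum _ fun i _ => (hy i).mul
      (ih hA fun j => (hA i j).mul (hy j))).div_const _

theorem hasDerivAt_cliqueForm (hA : ∀ i j, A i j = A j i) (r : ℕ) :
    ∀ {z : ℝ → ι → ℝ} {z' : ι → ℝ} {s : ℝ}, (∀ i, HasDerivAt (fun ε => z ε i) (z' i) s) →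
      HasDerivAt (fun ε => cliqueForm A (r + 1) (z ε))
        (∑ i, z' i * cliqueForm A r (fun j => A i j * z s j)) s := by
  induction r with
  | zero =>
    intro z z' s hz
    simp only [zero_add, cliqueForm_one]
    simpa [cliqueForm] using HasDerivAt.fun_sum fun i (_ : i ∈ Finset.univ) => hz i
  | succ r ih =>
    intro z z' s hz
    simp only [cliqueForm_succ A (r + 1)]
    have h : ∀ i, HasDerivAt (fun ε => z ε i * cliqueForm A (r + 1) (fun j => A i j * z ε j))
        (z' i * cliqueForm A (r + 1) (fun j => A i j * z s j) + z s i *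
          ∑ j, A i j * z' j * cliqueForm A r (fun l => A j l * (A i l * z s l))) s :=
      fun i => (hz i).mul (ih (z := fun ε j => A i j * z ε j) fun j => (hz j).const_mul (A i j))
    refine ((HasDerivAt.fun_sum fun i (_ : i ∈ Finset.univ) => h i).div_const _).congr_deriv ?_
    rw [Finset.sum_add_distrib]
    have h2 : ∑ i, z s i *
          ∑ j, A i j * z' j * cliqueForm A r (fun l => A j l * (A i l * z s l)) =
        ((r : ℝ) + 1) * ∑ j, z' j * cliqueForm A (r + 1) (fun l => A j l * z s l) := by
      simp only [Finset.mul_sum]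
      rw [Finset.sum_comm]
      refine Finset.sum_congr rfl fun j _ => ?_
      rw [mul_left_comm, succ_mul_cliqueForm, Finset.mul_sum]
      refine Finset.sum_congr rfl fun i _ => ?_
      rw [show (fun l => A j l * (A i l * z s l)) = fun l => A i l * (A j l * z s l) from
        funext fun l => by ring, hA i j]
      ring
    rw [h2]
    push_cast
    field_simp
    ring

end CliqueForm

section Bridge

variable {k : ℕ} {A : Fin k → Fin k → ℝ}

theorem prod_pairs_insert (hA : ∀ i j, A i j = A j i) {p : Fin k} {X : Finset (Fin k)}
    (hp : p ∉ X) :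
    ∏ i ∈ insert p X, ∏ j ∈ (insert p X).filter (fun j => i < j), A i j =
      (∏ i ∈ X, ∏ j ∈ X.filter (fun j => i < j), A i j) * ∏ j ∈ X, A p j := by
  rw [Finset.prod_insert hp, Finset.filter_insert, if_neg (lt_irrefl p)]
  have h : ∀ i ∈ X, ∏ j ∈ (insert p X).filter (fun j => i < j), A i j =
      (∏ j ∈ X.filter (fun j => i < j), A i j) * if i < p then A p i else 1 := by
    intro i _
    rw [Finset.filter_insert]
    split_ifs with h
    · rw [Finset.prod_insert (by simp [hp]), hA i p, mul_comm]
    · rw [mul_one]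
  rw [Finset.prod_congr rfl h, Finset.prod_mul_distrib, mul_left_comm, Finset.prod_filter,
    ← Finset.prod_mul_distrib]
  congr 1
  refine Finset.prod_congr rfl fun i hi => ?_
  have hne : i ≠ p := fun h => hp (h ▸ hi)
  rcases lt_or_gt_of_ne hne with h | h
  · simp [h, h.not_gt]
  · simp [h, h.not_gt]

theorem sum_powersetCard_insert {α : Type*} [DecidableEq α] [Fintype α] (r : ℕ)
    (f : Finset α → ℝ) :
    ∑ i, ∑ X ∈ Finset.powersetCard r Finset.univ with i ∉ X, f (insert i X) =
      ((r : ℝ) + 1) * ∑ Y ∈ Finset.powersetCard (r + 1) (Finset.univ : Finset α), f Y := by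
  have h1 : ∀ i : α, ∑ X ∈ Finset.powersetCard r Finset.univ with i ∉ X, f (insert i X) =
      ∑ Y ∈ Finset.powersetCard (r + 1) (Finset.univ : Finset α) with i ∈ Y, f Y := by
    intro i
    refine Finset.sum_bij' (fun X _ => insert i X) (fun Y _ => Y.erase i) ?_ ?_ ?_ ?_ ?_
    · intro X hX
      simp only [Finset.mem_filter, Finset.mem_powersetCard_univ] at hX ⊢
      exact ⟨by rw [Finset.card_insert_of_notMem hX.2, hX.1], Finset.mem_insert_self _ _⟩
    · intro Y hY
      simp only [Finset.mem_filter, Finset.mem_powersetCard_univ] at hY ⊢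
      exact ⟨by rw [Finset.card_erase_of_mem hY.2, hY.1]; rfl, Finset.notMem_erase _ _⟩
    · intro X hX
      exact Finset.erase_insert (Finset.mem_filter.1 hX).2
    · intro Y hY
      exact Finset.insert_erase (Finset.mem_filter.1 hY).2
    · intro X _; rfl
  simp only [h1, Finset.sum_filter]
  rw [Finset.sum_comm, Finset.mul_sum]
  refine Finset.sum_congr rfl fun Y hY => ?_
  rw [← Finset.sum_filter, Finset.sum_const, nsmul_eq_mul, Finset.filter_mem_eq_inter,
    Finset.univ_inter, Finset.mem_powersetCard_univ.1 hY]
  push_cast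
  rfl

theorem L_eq_cliqueForm (hA : IsWeight A) (r : ℕ) :
    ∀ y : Fin k → ℝ, L k r A y = cliqueForm A r y := by
  induction r with
  | zero => intro y; simp [L, cliqueForm]
  | succ r ih =>
    intro y
    rw [cliqueForm_succ, eq_div_iff (by positivity), mul_comm, L, ← sum_powersetCard_insert]
    refine Finset.sum_congr rfl fun i _ => ?_
    rw [← ih, L, Finset.sum_filter, Finset.mul_sum]
    refine Finset.sum_congr rfl fun X _ => ?_
    split_ifs with hX
    · rw [Finset.prod_eq_zero (f := fun j => A i j * y j) hX (by rw [hA.diag, zero_mul])]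
      ring
    · rw [prod_pairs_insert hA.symm hX, Finset.prod_insert hX, Finset.prod_mul_distrib]
      ring

end Bridge

section Inequalities

variable {ι : Type*} [Fintype ι] {A : ι → ι → ℝ} {y : ι → ℝ}

/-- Weighted degree. -/
noncomputable def wdeg (A : ι → ι → ℝ) (y : ι → ℝ) (i : ι) : ℝ := ∑ j, A i j * y j

/-- Weighted codegree. -/
noncomputable def codeg (A : ι → ι → ℝ) (y : ι → ℝ) (i j : ι) : ℝ := ∑ l, A i l * A j l * y l

/-- Weighted codegree of a triple. -/
noncomputable def codegThree (A : ι → ι → ℝ) (y : ι → ℝ) (i j k : ι) : ℝ :=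
  ∑ l, A i l * A j l * A k l * y l

/-- The sum of a function over ordered weighted triangles. -/
noncomputable def triSum (A : ι → ι → ℝ) (y : ι → ℝ) (g : ι → ι → ι → ℝ) : ℝ :=
  ∑ i, ∑ j, ∑ k, A i j * A j k * A i k * (y i * y j * y k) * g i j k

theorem triSum_swap_left (hA : IsWeight A) (g : ι → ι → ι → ℝ) :
    triSum A y (fun i j k => g j i k) = triSum A y g := by
  unfold triSum
  rw [Finset.sum_comm]
  refine Finset.sum_congr rfl fun i _ => Finset.sum_congr rfl fun j _ =>
    Finset.sum_congr rfl fun k _ => ?_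
  rw [hA.symm j i]; ring

theorem triSum_swap_right (hA : IsWeight A) (g : ι → ι → ι → ℝ) :
    triSum A y (fun i j k => g i k j) = triSum A y g := by
  unfold triSum
  refine Finset.sum_congr rfl fun i _ => ?_
  rw [Finset.sum_comm]
  refine Finset.sum_congr rfl fun j _ => Finset.sum_congr rfl fun k _ => ?_
  rw [hA.symm k j]; ring

theorem triSum_add (g h : ι → ι → ι → ℝ) :
    triSum A y (fun i j k => g i j k + h i j k) = triSum A y g + triSum A y h := by
  simp only [triSum, mul_add, Finset.sum_add_distrib]

theorem triSum_const_mul (c : ℝ) (g : ι → ι → ι → ℝ) :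
    triSum A y (fun i j k => c * g i j k) = c * triSum A y g := by
  simp only [triSum, Finset.mul_sum]
  refine Finset.sum_congr rfl fun i _ => Finset.sum_congr rfl fun j _ =>
    Finset.sum_congr rfl fun k _ => by ring

theorem triSum_nonneg (hA : IsWeight A) (hy : ∀ i, 0 ≤ y i) {g : ι → ι → ι → ℝ}
    (hg : ∀ i j k, 0 ≤ g i j k) : 0 ≤ triSum A y g :=
  Finset.sum_nonneg fun i _ => Finset.sum_nonneg fun j _ => Finset.sum_nonneg fun k _ =>
    mul_nonneg (mul_nonneg (mul_nonneg (mul_nonneg (hA.nonneg _ _) (hA.nonneg _ _))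
      (hA.nonneg _ _)) (mul_nonneg (mul_nonneg (hy i) (hy j)) (hy k))) (hg i j k)

theorem triSum_pair (A : ι → ι → ℝ) (y : ι → ℝ) (f : ι → ι → ℝ) :
    triSum A y (fun i j _ => f i j) = ∑ i, ∑ j, A i j * (y i * y j) * (f i j * codeg A y i j) := by
  unfold triSum codeg
  refine Finset.sum_congr rfl fun i _ => Finset.sum_congr rfl fun j _ => ?_
  rw [Finset.mul_sum, Finset.mul_sum]
  exact Finset.sum_congr rfl fun k _ => by ring

theorem cliqueForm_two (A : ι → ι → ℝ) (y : ι → ℝ) :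
    2 * cliqueForm A 2 y = ∑ i, y i * wdeg A y i := by
  have := succ_mul_cliqueForm A 1 y
  simp only [cliqueForm_one] at this
  norm_num at this
  exact this

theorem cliqueForm_two_link (A : ι → ι → ℝ) (y : ι → ℝ) (i : ι) :
    2 * cliqueForm A 2 (fun j => A i j * y j) = ∑ j, A i j * y j * codeg A y i j := by
  rw [cliqueForm_two]
  refine Finset.sum_congr rfl fun j _ => ?_
  congr 1
  exact Finset.sum_congr rfl fun l _ => by ring

theorem cliqueForm_three (A : ι → ι → ℝ) (y : ι → ℝ) :
    3 * cliqueForm A 3 y = ∑ i, y i * cliqueForm A 2 (fun j => A i j * y j) := by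
  have := succ_mul_cliqueForm A 2 y
  norm_num at this
  exact this

theorem cliqueForm_four (A : ι → ι → ℝ) (y : ι → ℝ) :
    4 * cliqueForm A 4 y = ∑ i, y i * cliqueForm A 3 (fun j => A i j * y j) := by
  have := succ_mul_cliqueForm A 3 y
  norm_num at this
  exact this

theorem cliqueForm_three_eq_triSum (A : ι → ι → ℝ) (y : ι → ℝ) :
    6 * cliqueForm A 3 y = triSum A y (fun _ _ _ => 1) := by
  have h : 6 * cliqueForm A 3 y = 2 * (3 * cliqueForm A 3 y) := by ring
  rw [h, cliqueForm_three, Finset.mul_sum, triSum]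
  refine Finset.sum_congr rfl fun i _ => ?_
  rw [mul_left_comm, cliqueForm_two, Finset.mul_sum]
  refine Finset.sum_congr rfl fun j _ => ?_
  rw [wdeg, Finset.mul_sum, Finset.mul_sum]
  exact Finset.sum_congr rfl fun k _ => by ring

theorem cliqueForm_four_eq_triSum (A : ι → ι → ℝ) (y : ι → ℝ) :
    24 * cliqueForm A 4 y = triSum A y (codegThree A y) := by
  have h : 24 * cliqueForm A 4 y = 6 * (4 * cliqueForm A 4 y) := by ring
  rw [h, cliqueForm_four, Finset.mul_sum, triSum]
  refine Finset.sum_congr rfl fun i _ => ?_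
  rw [mul_left_comm, cliqueForm_three_eq_triSum, triSum, Finset.mul_sum]
  refine Finset.sum_congr rfl fun j _ => ?_
  rw [Finset.mul_sum]
  refine Finset.sum_congr rfl fun k _ => ?_
  rw [codegThree, Finset.mul_sum, Finset.mul_sum]
  exact Finset.sum_congr rfl fun l _ => by ring

theorem triSum_codeg (A : ι → ι → ℝ) (y : ι → ℝ) :
    triSum A y (fun i j _ => codeg A y i j) =
      ∑ i, ∑ j, A i j * (y i * y j) * codeg A y i j ^ 2 := by
  rw [triSum_pair]
  exact Finset.sum_congr rfl fun i _ => Finset.sum_congr rfl fun j _ => by ring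

theorem triSum_wdeg (A : ι → ι → ℝ) (y : ι → ℝ) :
    triSum A y (fun i _ _ => wdeg A y i) =
      2 * ∑ i, y i * (wdeg A y i * cliqueForm A 2 (fun j => A i j * y j)) := by
  rw [triSum_pair, Finset.mul_sum]
  refine Finset.sum_congr rfl fun i _ => ?_
  rw [show 2 * (y i * (wdeg A y i * cliqueForm A 2 (fun j => A i j * y j))) =
    y i * wdeg A y i * (2 * cliqueForm A 2 (fun j => A i j * y j)) by ring,
    cliqueForm_two_link A y, Finset.mul_sum]
  exact Finset.sum_congr rfl fun j _ => by ring

theorem codeg_lower (hA : IsWeight A) (hy : ∀ i, 0 ≤ y i) (i j : ι) :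
    0 ≤ codeg A y i j - wdeg A y i - wdeg A y j + ∑ l, y l := by
  simp only [codeg, wdeg, ← Finset.sum_sub_distrib, ← Finset.sum_add_distrib]
  refine Finset.sum_nonneg fun l _ => ?_
  have : 0 ≤ y l * ((1 - A i l) * (1 - A j l)) := mul_nonneg (hy l)
    (mul_nonneg (sub_nonneg.2 (hA.le_one _ _)) (sub_nonneg.2 (hA.le_one _ _)))
  linarith

theorem sum_pair_wdeg_left (A : ι → ι → ℝ) (y : ι → ℝ) :
    ∑ i, ∑ j, A i j * (y i * y j) * wdeg A y i = ∑ i, y i * wdeg A y i ^ 2 := by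
  refine Finset.sum_congr rfl fun i _ => ?_
  rw [sq, ← mul_assoc, ← Finset.sum_mul]
  congr 1
  rw [wdeg, Finset.mul_sum]
  exact Finset.sum_congr rfl fun j _ => by ring

theorem sum_pair_wdeg_right (hA : IsWeight A) :
    ∑ i, ∑ j, A i j * (y i * y j) * wdeg A y j = ∑ i, y i * wdeg A y i ^ 2 := by
  rw [← sum_pair_wdeg_left, Finset.sum_comm]
  refine Finset.sum_congr rfl fun i _ => Finset.sum_congr rfl fun j _ => ?_
  rw [hA.symm j i]; ring

theorem sum_pair_one (A : ι → ι → ℝ) (y : ι → ℝ) :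
    ∑ i, ∑ j, A i j * (y i * y j) = 2 * cliqueForm A 2 y := by
  rw [cliqueForm_two]
  refine Finset.sum_congr rfl fun i _ => ?_
  rw [wdeg, Finset.mul_sum]
  exact Finset.sum_congr rfl fun j _ => by ring

theorem sum_pair_codeg (A : ι → ι → ℝ) (y : ι → ℝ) :
    ∑ i, ∑ j, A i j * (y i * y j) * codeg A y i j = 6 * cliqueForm A 3 y := by
  rw [cliqueForm_three_eq_triSum, triSum_pair]
  simp only [one_mul]

/-- Goodman's inequality. -/
theorem goodman (hA : IsWeight A) (hy : ∀ i, 0 ≤ y i) :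
    cliqueForm A 2 y * (4 * cliqueForm A 2 y - (∑ i, y i) ^ 2) ≤
      3 * (∑ i, y i) * cliqueForm A 3 y := by
  set T := ∑ i, y i with hT
  have hT0 : 0 ≤ T := Finset.sum_nonneg fun i _ => hy i
  have h1 : 0 ≤ ∑ i, ∑ j, A i j * (y i * y j) *
      (codeg A y i j - wdeg A y i - wdeg A y j + T) :=
    Finset.sum_nonneg fun i _ => Finset.sum_nonneg fun j _ =>
      mul_nonneg (mul_nonneg (hA.nonneg _ _) (mul_nonneg (hy i) (hy j))) (codeg_lower hA hy i j)
  have e : ∑ i, ∑ j, A i j * (y i * y j) * (codeg A y i j - wdeg A y i - wdeg A y j + T) =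
      (∑ i, ∑ j, A i j * (y i * y j) * codeg A y i j)
      - (∑ i, ∑ j, A i j * (y i * y j) * wdeg A y i)
      - (∑ i, ∑ j, A i j * (y i * y j) * wdeg A y j)
      + T * (∑ i, ∑ j, A i j * (y i * y j)) := by
    simp only [Finset.mul_sum, ← Finset.sum_add_distrib, ← Finset.sum_sub_distrib]
    exact Finset.sum_congr rfl fun i _ => Finset.sum_congr rfl fun j _ => by ring
  rw [e, sum_pair_codeg, sum_pair_wdeg_left, sum_pair_wdeg_right hA, sum_pair_one] at h1
  have h2 : (∑ i, y i * wdeg A y i) ^ 2 ≤ T * ∑ i, y i * wdeg A y i ^ 2 :=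
    Finset.sum_sq_le_sum_mul_sum_of_sq_le_mul _ (fun i _ => hy i)
      (fun i _ => mul_nonneg (hy i) (sq_nonneg _)) fun i _ => le_of_eq (by ring)
  rw [← cliqueForm_two] at h2
  nlinarith [mul_nonneg hT0 h1]

/-- The Moon–Moser inequality relating cliques on two, three and four vertices. -/
theorem moon_moser (hA : IsWeight A) (hy : ∀ i, 0 ≤ y i) (hy1 : ∑ i, y i = 1) :
    cliqueForm A 3 y * (9 * cliqueForm A 3 y - cliqueForm A 2 y) ≤
      8 * cliqueForm A 2 y * cliqueForm A 4 y := by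
  have h1 : 0 ≤ triSum A y (fun i j k => 1 + (2 * codegThree A y i j k +
      ((-1) * codeg A y i j + ((-1) * codeg A y j k + (-1) * codeg A y i k)))) := by
    refine triSum_nonneg hA hy fun i j k => ?_
    have e : (∑ l, y l) + (2 * codegThree A y i j k +
      ((-1) * codeg A y i j + ((-1) * codeg A y j k + (-1) * codeg A y i k))) =
      ∑ l, y l * (1 + 2 * (A i l * A j l * A k l) - A i l * A j l - A j l * A k l -
        A i l * A k l) := by
      simp only [codegThree, codeg, Finset.mul_sum, ← Finset.sum_add_distrib]
      exact Finset.sum_congr rfl fun l _ => by ring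
    rw [hy1] at e
    rw [e]
    refine Finset.sum_nonneg fun l _ => mul_nonneg (hy l) ?_
    have a0 := hA.nonneg i l
    have b0 := hA.nonneg j l
    have c0 := hA.nonneg k l
    have a1 := sub_nonneg.2 (hA.le_one i l)
    have b1 := sub_nonneg.2 (hA.le_one j l)
    have c1 := sub_nonneg.2 (hA.le_one k l)
    nlinarith [mul_nonneg (mul_nonneg a1 b1) c1, mul_nonneg (mul_nonneg a0 b1) c1,
      mul_nonneg (mul_nonneg a1 b0) c1, mul_nonneg (mul_nonneg a1 b1) c0]
  rw [triSum_add, triSum_add, triSum_add, triSum_add, triSum_const_mul, triSum_const_mul,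
    triSum_const_mul, triSum_const_mul, ← cliqueForm_three_eq_triSum,
    ← cliqueForm_four_eq_triSum] at h1
  have e1 : triSum A y (fun i _ k => codeg A y i k) = triSum A y (fun i j _ => codeg A y i j) :=
    triSum_swap_right hA fun i j _ => codeg A y i j
  have e2 : triSum A y (fun _ j k => codeg A y j k) = triSum A y (fun i j _ => codeg A y i j) := by
    rw [← e1]
    exact triSum_swap_left hA fun i _ k => codeg A y i k
  rw [e1, e2, triSum_codeg] at h1
  have h2 : (∑ i, ∑ j, A i j * (y i * y j) * codeg A y i j) ^ 2 ≤
      (∑ i, ∑ j, A i j * (y i * y j)) * ∑ i, ∑ j, A i j * (y i * y j) * codeg A y i j ^ 2 := by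
    simp only [← Fintype.sum_prod_type']
    have hw : ∀ p : ι × ι, 0 ≤ A p.1 p.2 * (y p.1 * y p.2) := fun p =>
      mul_nonneg (hA.nonneg _ _) (mul_nonneg (hy _) (hy _))
    exact Finset.sum_sq_le_sum_mul_sum_of_sq_le_mul _ (fun p _ => hw p)
      (fun p _ => mul_nonneg (hw p) (sq_nonneg _)) fun p _ => le_of_eq (by ring)
  rw [sum_pair_codeg, sum_pair_one] at h2
  have h3 := cliqueForm_nonneg hA 2 y hy
  nlinarith [mul_nonneg h3 h1]

/-- An upper bound on the number of four-cliques for stationary weights. -/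
theorem cliqueForm_four_le (hA : IsWeight A) (hy : ∀ i, 0 ≤ y i) (hy1 : ∑ i, y i = 1)
    {lam mu : ℝ}
    (hvert : ∀ i, y i * cliqueForm A 2 (fun j => A i j * y j) = y i * (lam * wdeg A y i + mu))
    (hedge : 0 ≤ ∑ i, ∑ j, A i j * (y i * y j) *
      ((codeg A y i j - wdeg A y i - wdeg A y j + 1) * (lam - codeg A y i j))) :
    4 * cliqueForm A 4 y ≤ cliqueForm A 3 y * (3 * lam - 2) +
      (2 * mu + lam) * cliqueForm A 2 y := by
  have h1 : 0 ≤ triSum A y (fun i j k => 1 + ((-1) * codegThree A y i j k +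
      (codeg A y i j + (codeg A y j k + (codeg A y i k + ((-1) * wdeg A y i +
        ((-1) * wdeg A y j + (-1) * wdeg A y k))))))) := by
    refine triSum_nonneg hA hy fun i j k => ?_
    have e : (∑ l, y l) + ((-1) * codegThree A y i j k +
      (codeg A y i j + (codeg A y j k + (codeg A y i k + ((-1) * wdeg A y i +
        ((-1) * wdeg A y j + (-1) * wdeg A y k)))))) =
      ∑ l, y l * ((1 - A i l) * (1 - A j l) * (1 - A k l)) := by
      simp only [codegThree, codeg, wdeg, Finset.mul_sum, ← Finset.sum_add_distrib]
      exact Finset.sum_congr rfl fun l _ => by ring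
    rw [hy1] at e
    rw [e]
    exact Finset.sum_nonneg fun l _ => mul_nonneg (hy l) (mul_nonneg (mul_nonneg
      (sub_nonneg.2 (hA.le_one i l)) (sub_nonneg.2 (hA.le_one j l)))
      (sub_nonneg.2 (hA.le_one k l)))
  simp only [triSum_add, triSum_const_mul, ← cliqueForm_three_eq_triSum] at h1
  rw [← cliqueForm_four_eq_triSum] at h1
  have e1 : triSum A y (fun i _ k => codeg A y i k) = triSum A y (fun i j _ => codeg A y i j) :=
    triSum_swap_right hA fun i j _ => codeg A y i j
  have e2 : triSum A y (fun _ j k => codeg A y j k) = triSum A y (fun i j _ => codeg A y i j) := by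
    rw [← e1]
    exact triSum_swap_left hA fun i _ k => codeg A y i k
  have e3 : triSum A y (fun _ j _ => wdeg A y j) = triSum A y (fun i _ _ => wdeg A y i) :=
    triSum_swap_left hA fun i _ _ => wdeg A y i
  have e4 : triSum A y (fun _ _ k => wdeg A y k) = triSum A y (fun i _ _ => wdeg A y i) := by
    rw [← e3]
    exact triSum_swap_right hA fun _ j _ => wdeg A y j
  rw [e1, e2, e3, e4] at h1
  have e5 : triSum A y (fun i _ _ => wdeg A y i) =
      2 * (lam * ∑ i, y i * wdeg A y i ^ 2) + 4 * mu * cliqueForm A 2 y := by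
    rw [triSum_wdeg A y, show 4 * mu * cliqueForm A 2 y = 2 * mu * (2 * cliqueForm A 2 y) by ring,
      cliqueForm_two]
    simp only [Finset.mul_sum, ← Finset.sum_add_distrib]
    refine Finset.sum_congr rfl fun i _ => ?_
    linear_combination 2 * wdeg A y i * hvert i
  have e6 : ∑ i, ∑ j, A i j * (y i * y j) *
      ((codeg A y i j - wdeg A y i - wdeg A y j + 1) * (lam - codeg A y i j)) =
      (lam - 1) * (∑ i, ∑ j, A i j * (y i * y j) * codeg A y i j)
      - lam * (∑ i, ∑ j, A i j * (y i * y j) * wdeg A y i)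
      - lam * (∑ i, ∑ j, A i j * (y i * y j) * wdeg A y j)
      + lam * (∑ i, ∑ j, A i j * (y i * y j))
      - (∑ i, ∑ j, A i j * (y i * y j) * codeg A y i j ^ 2)
      + (∑ i, ∑ j, A i j * (y i * y j) * (wdeg A y i * codeg A y i j))
      + (∑ i, ∑ j, A i j * (y i * y j) * (wdeg A y j * codeg A y i j)) := by
    simp only [Finset.mul_sum, ← Finset.sum_add_distrib, ← Finset.sum_sub_distrib]
    exact Finset.sum_congr rfl fun i _ => Finset.sum_congr rfl fun j _ => by ring
  rw [e6, ← triSum_codeg, ← triSum_pair A y fun i _ => wdeg A y i,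
    ← triSum_pair A y fun _ j => wdeg A y j, e3, sum_pair_codeg, sum_pair_wdeg_left,
    sum_pair_wdeg_right hA, sum_pair_one] at hedge
  rw [e5] at h1 hedge
  nlinarith

end Inequalities

section Variation

variable {ι : Type*} [Fintype ι]

/-- The value of the second clique form at the vector with `t` coordinates equal to `x` and one
coordinate equal to `1 - t x`. -/
noncomputable def edgePoly (t x : ℝ) : ℝ := t * x - t * (t + 1) / 2 * x ^ 2

/-- The larger root of `edgePoly t x = c`. -/
noncomputable def edgeRoot (t c : ℝ) : ℝ := (1 + √(1 - 2 * (t + 1) * c / t)) / (t + 1)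

theorem edgeRoot_edgePoly {t x : ℝ} (ht : 0 < t) (hx : 1 / (t + 1) ≤ x) :
    edgeRoot t (edgePoly t x) = x := by
  have h1 : 1 ≤ x * (t + 1) := by rwa [div_le_iff₀ (by positivity)] at hx
  have h2 : 1 - 2 * (t + 1) * edgePoly t x / t = (x * (t + 1) - 1) ^ 2 := by
    unfold edgePoly; field_simp; ring
  rw [edgeRoot, h2, Real.sqrt_sq (by linarith)]
  field_simp
  ring

theorem exists_edgePoly_eq {t c : ℝ} (ht : 0 < t) (h1 : edgePoly t (1 / t) ≤ c)
    (h2 : c ≤ edgePoly t (1 / (t + 1))) :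
    ∃ x, 1 / (t + 1) ≤ x ∧ x ≤ 1 / t ∧ c = edgePoly t x := by
  have hle : 1 / (t + 1) ≤ 1 / t := one_div_le_one_div_of_le ht (by linarith)
  have hc : ContinuousOn (edgePoly t) (Set.Icc (1 / (t + 1)) (1 / t)) := by
    unfold edgePoly; fun_prop
  obtain ⟨x, hx, hxc⟩ := intermediate_value_Icc' hle hc ⟨h1, h2⟩
  exact ⟨x, hx.1, hx.2, hxc.symm⟩

theorem continuous_edgeRoot (t : ℝ) : Continuous (edgeRoot t) := by
  unfold edgeRoot; fun_prop

theorem hasDerivAt_edgeRoot {t x : ℝ} (ht : 0 < t) (hx : 1 / (t + 1) < x) :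
    HasDerivAt (edgeRoot t) (t - t * (t + 1) * x)⁻¹ (edgePoly t x) := by
  have h1 : 1 < x * (t + 1) := by rwa [div_lt_iff₀ (by positivity)] at hx
  have h2 : 1 - 2 * (t + 1) * edgePoly t x / t = (x * (t + 1) - 1) ^ 2 := by
    unfold edgePoly; field_simp; ring
  have h3 : HasDerivAt (fun c : ℝ => 1 - 2 * (t + 1) * c / t) (-(2 * (t + 1) / t))
      (edgePoly t x) := by
    have := (((hasDerivAt_id (edgePoly t x)).const_mul (2 * (t + 1))).div_const t).const_sub 1
    simpa using this
  have h4 : x * (t + 1) - 1 ≠ 0 := by linarith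
  have h5 := ((h3.sqrt (by rw [h2]; positivity)).const_add 1).div_const (t + 1)
  refine h5.congr_deriv ?_
  rw [h2, Real.sqrt_sq (by linarith)]
  have h6 : t - t * (t + 1) * x = -(t * (x * (t + 1) - 1)) := by ring
  rw [h6]
  field_simp

/-- `(A, y)` satisfies the first order condition for minimizing `K_r` under a constraint on `K_2`,
with multiplier `l`, along all admissible one-sided variations. -/
def IsStationaryPair (r : ℕ) (A : ι → ι → ℝ) (y : ι → ℝ) (l : ℝ) : Prop :=
  ∀ (B : ℝ → ι → ι → ℝ) (z : ℝ → ι → ℝ) (a b : ℝ), B 0 = A → z 0 = y →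
    (∀ ε, 0 ≤ ε → ε ≤ 1 / 2 → IsWeight (B ε) ∧ (∀ i, 0 ≤ z ε i) ∧ ∑ i, z ε i = 1) →
    HasDerivAt (fun ε => cliqueForm (B ε) 2 (z ε)) a 0 →
    HasDerivAt (fun ε => cliqueForm (B ε) r (z ε)) b 0 → l * a ≤ b

theorem exists_stationary (r : ℕ) {t : ℝ} (ht : 0 < t) {F Λ : ℝ → ℝ}
    (hF : ∀ x, HasDerivAt F (Λ x * (t - t * (t + 1) * x)) x)
    (hend : ∀ (A : ι → ι → ℝ) (y : ι → ℝ), IsWeight A → (∀ i, 0 ≤ y i) → ∑ i, y i = 1 →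
      ∀ x, x = 1 / t ∨ x = 1 / (t + 1) → cliqueForm A 2 y = edgePoly t x → F x ≤ cliqueForm A r y)
    {A₀ : ι → ι → ℝ} {y₀ : ι → ℝ} {x₀ : ℝ} (hA₀ : IsWeight A₀) (hy₀ : ∀ i, 0 ≤ y₀ i)
    (hs₀ : ∑ i, y₀ i = 1) (hx₀ : 1 / (t + 1) ≤ x₀) (hx₀' : x₀ ≤ 1 / t)
    (hc₀ : cliqueForm A₀ 2 y₀ = edgePoly t x₀) (hlt : cliqueForm A₀ r y₀ < F x₀) :
    ∃ (A : ι → ι → ℝ) (y : ι → ℝ) (x : ℝ), IsWeight A ∧ (∀ i, 0 ≤ y i) ∧ ∑ i, y i = 1 ∧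
      1 / (t + 1) < x ∧ x < 1 / t ∧ cliqueForm A 2 y = edgePoly t x ∧ cliqueForm A r y < F x ∧
      IsStationaryPair r A y (Λ x) := by
  set lo := edgePoly t (1 / t) with hlo
  set hi := edgePoly t (1 / (t + 1)) with hhi
  have hK : ∀ r, Continuous fun p : (ι → ι → ℝ) × (ι → ℝ) => cliqueForm p.1 r p.2 := fun r =>
    continuous_cliqueForm r (fun i j => by fun_prop) (fun i => by fun_prop)
  let Z : Set ((ι → ι → ℝ) × (ι → ℝ)) := {p | IsWeight p.1 ∧ (∀ i, 0 ≤ p.2 i) ∧ ∑ i, p.2 i = 1 ∧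
    lo ≤ cliqueForm p.1 2 p.2 ∧ cliqueForm p.1 2 p.2 ≤ hi}
  have hFc : Continuous F := continuous_iff_continuousAt.2 fun x => (hF x).continuousAt
  have hZc : IsCompact Z := by
    have hbox : IsCompact ((Set.Icc (fun _ _ => 0) (fun _ _ => 1) : Set (ι → ι → ℝ)) ×ˢ
        (Set.Icc (fun _ => 0) (fun _ => 1) : Set (ι → ℝ))) := isCompact_Icc.prod isCompact_Icc
    refine hbox.of_isClosed_subset ?_ ?_
    · have e : Z = {p : (ι → ι → ℝ) × (ι → ℝ) | ∀ i, p.1 i i = 0} ∩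
          {p | ∀ i j, 0 ≤ p.1 i j} ∩ {p | ∀ i j, p.1 i j ≤ 1} ∩
          {p | ∀ i j, p.1 i j = p.1 j i} ∩ {p | ∀ i, 0 ≤ p.2 i} ∩ {p | ∑ i, p.2 i = 1} ∩
          {p | lo ≤ cliqueForm p.1 2 p.2} ∩ {p | cliqueForm p.1 2 p.2 ≤ hi} := by
        ext p
        constructor
        · rintro ⟨⟨h1, h2, h3, h4⟩, h5, h6, h7, h8⟩
          exact ⟨⟨⟨⟨⟨⟨⟨h1, h2⟩, h3⟩, h4⟩, h5⟩, h6⟩, h7⟩, h8⟩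
        · rintro ⟨⟨⟨⟨⟨⟨⟨h1, h2⟩, h3⟩, h4⟩, h5⟩, h6⟩, h7⟩, h8⟩
          exact ⟨⟨h1, h2, h3, h4⟩, h5, h6, h7, h8⟩
      rw [e]
      simp only [Set.ofPred_forall]
      refine ((((((((isClosed_iInter fun i => ?_).inter (isClosed_iInter fun i =>
        isClosed_iInter fun j => ?_)).inter (isClosed_iInter fun i =>
        isClosed_iInter fun j => ?_)).inter (isClosed_iInter fun i =>
        isClosed_iInter fun j => ?_)).inter (isClosed_iInter fun i => ?_)).inter ?_).inter ?_).inter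
        ?_)
      · exact isClosed_eq (by fun_prop) (by fun_prop)
      · exact isClosed_le (by fun_prop) (by fun_prop)
      · exact isClosed_le (by fun_prop) (by fun_prop)
      · exact isClosed_eq (by fun_prop) (by fun_prop)
      · exact isClosed_le (by fun_prop) (by fun_prop)
      · exact isClosed_eq (by fun_prop) (by fun_prop)
      · exact isClosed_le (by fun_prop) (hK 2)
      · exact isClosed_le (hK 2) (by fun_prop)
    · rintro p ⟨hA, hy, hs, -, -⟩
      refine ⟨⟨fun i j => hA.nonneg i j, fun i j => hA.le_one i j⟩, fun i => hy i, fun i => ?_⟩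
      show p.2 i ≤ 1
      rw [← hs]
      exact Finset.single_le_sum (fun j _ => hy j) (Finset.mem_univ i)
  let f : (ι → ι → ℝ) × (ι → ℝ) → ℝ := fun p =>
    cliqueForm p.1 r p.2 - F (edgeRoot t (cliqueForm p.1 2 p.2))
  have hf : Continuous f := (hK r).sub (hFc.comp ((continuous_edgeRoot t).comp (hK 2)))
  have hmono : ∀ u v : ℝ, 1 / (t + 1) ≤ u → u ≤ v → edgePoly t v ≤ edgePoly t u := by
    intro u v hu huv
    have h1 : 1 ≤ u * (t + 1) := by rwa [div_le_iff₀ (by positivity)] at hu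
    unfold edgePoly
    nlinarith [mul_nonneg (mul_nonneg ht.le (sub_nonneg.2 huv))
      (by nlinarith : 0 ≤ (u + v) * (t + 1) - 2)]
  have hmem₀ : (A₀, y₀) ∈ Z :=
    ⟨hA₀, hy₀, hs₀, by rw [hc₀]; exact hmono _ _ hx₀ hx₀', by rw [hc₀]; exact hmono _ _ le_rfl hx₀⟩
  obtain ⟨⟨A, y⟩, ⟨hA, hy, hs, hc1, hc2⟩, hmin⟩ :=
    hZc.exists_isMinOn ⟨_, hmem₀⟩ hf.continuousOn
  obtain ⟨x, hx1, hx2, hcx⟩ := exists_edgePoly_eq ht hc1 hc2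
  simp only at hA hy hs hc1 hc2 hcx
  have hval : cliqueForm A r y < F x := by
    have h := hmin hmem₀
    simp only [f, hc₀, Set.mem_ofPred_eq, hcx, edgeRoot_edgePoly ht hx₀,
      edgeRoot_edgePoly ht hx1] at h
    linarith
  have hx1' : 1 / (t + 1) < x := lt_of_le_of_ne hx1 fun h =>
    absurd (hend A y hA hy hs x (Or.inr h.symm) hcx) (not_le.2 hval)
  have hx2' : x < 1 / t := lt_of_le_of_ne hx2 fun h =>
    absurd (hend A y hA hy hs x (Or.inl h) hcx) (not_le.2 hval)
  refine ⟨A, y, x, hA, hy, hs, hx1', hx2', hcx, hval, ?_⟩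
  intro B z a b hB hz hBz ha hb
  have hne : t - t * (t + 1) * x ≠ 0 := by
    have h1 : 1 < x * (t + 1) := by rwa [div_lt_iff₀ (by positivity)] at hx1'
    nlinarith
  have hcx0 : cliqueForm (B 0) 2 (z 0) = edgePoly t x := by rw [hB, hz, hcx]
  have hroot : HasDerivAt (fun ε => edgeRoot t (cliqueForm (B ε) 2 (z ε)))
      ((t - t * (t + 1) * x)⁻¹ * a) 0 := by
    refine HasDerivAt.comp (h₂ := edgeRoot t) (0 : ℝ) ?_ ha
    rw [hcx0]
    exact hasDerivAt_edgeRoot ht hx1'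
  have hFr : HasDerivAt (fun ε => F (edgeRoot t (cliqueForm (B ε) 2 (z ε)))) (Λ x * a) 0 := by
    have h := HasDerivAt.comp (h₂ := F) (0 : ℝ) (by
      rw [hcx0, edgeRoot_edgePoly ht hx1]; exact hF x) hroot
    refine h.congr_deriv ?_
    rw [mul_assoc, mul_inv_cancel_left₀ hne]
  have hg := (hb.sub hFr).tendsto_slope_zero_right
  have hlo_lt : lo < cliqueForm (B 0) 2 (z 0) := by
    rw [hcx0]
    refine lt_of_le_of_ne (hmono _ _ hx1 hx2) fun h => hx2'.ne ?_
    rw [← edgeRoot_edgePoly ht hx1, ← h, hlo, edgeRoot_edgePoly ht (hx1.trans hx2)]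
  have hhi_lt : cliqueForm (B 0) 2 (z 0) < hi := by
    rw [hcx0]
    refine lt_of_le_of_ne (hmono _ _ le_rfl hx1) fun h => hx1'.ne ?_
    rw [← edgeRoot_edgePoly ht hx1, h, hhi, edgeRoot_edgePoly ht le_rfl]
  have hev : ∀ᶠ ε in nhdsWithin (0 : ℝ) (Set.Ioi 0),
      0 ≤ ε⁻¹ • ((cliqueForm (B (0 + ε)) r (z (0 + ε)) -
        F (edgeRoot t (cliqueForm (B (0 + ε)) 2 (z (0 + ε))))) -
        (cliqueForm (B 0) r (z 0) - F (edgeRoot t (cliqueForm (B 0) 2 (z 0))))) := by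
    have h1 := nhdsWithin_le_nhds (s := Set.Ioi (0 : ℝ))
      (ha.continuousAt.eventually (lt_mem_nhds hlo_lt))
    have h2 := nhdsWithin_le_nhds (s := Set.Ioi (0 : ℝ))
      (ha.continuousAt.eventually (gt_mem_nhds hhi_lt))
    have h3 := nhdsWithin_le_nhds (s := Set.Ioi (0 : ℝ))
      (gt_mem_nhds (show (0 : ℝ) < 1 / 2 by norm_num))
    filter_upwards [h1, h2, h3, self_mem_nhdsWithin] with ε h1 h2 h3 h4
    obtain ⟨hB1, hz1, hz2⟩ := hBz ε (le_of_lt h4) (le_of_lt h3)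
    have h := hmin (show (B ε, z ε) ∈ Z from ⟨hB1, hz1, hz2, le_of_lt h1, le_of_lt h2⟩)
    simp only [f, Set.mem_ofPred_eq] at h
    rw [zero_add, hB, hz, smul_eq_mul]
    exact mul_nonneg (inv_nonneg.2 (le_of_lt h4)) (sub_nonneg.2 h)
  by_contra hcon
  have h := ge_of_tendsto hg hev
  linarith

end Variation

section FirstOrder

variable {ι : Type*} [Fintype ι] {A : ι → ι → ℝ} {y : ι → ℝ} {l : ℝ}

theorem IsStationaryPair.vertex {r : ℕ} (h : IsStationaryPair (r + 1) A y l) (hA : IsWeight A)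
    (hy : ∀ i, 0 ≤ y i) (hy1 : ∑ i, y i = 1) (p : ι) :
    y p * cliqueForm A r (fun j => A p j * y j) = y p * (l * wdeg A y p +
      (((r : ℝ) + 1) * cliqueForm A (r + 1) y - 2 * l * cliqueForm A 2 y)) := by
  classical
  have hyp : y p ≤ 1 := hy1 ▸ Finset.single_le_sum (fun j _ => hy j) (Finset.mem_univ p)
  have hsum : ∀ (f : ι → ℝ) (σ : ℝ), ∑ i, y i * (σ * ((if i = p then 1 else 0) - y p)) * f i =
      σ * (y p * f p - y p * ∑ i, y i * f i) := by
    intro f σ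
    have e : ∀ i, y i * (σ * ((if i = p then 1 else 0) - y p)) * f i =
        (if i = p then σ * (y i * f i) else 0) - σ * y p * (y i * f i) := by
      intro i; split_ifs <;> ring
    simp only [e, Finset.sum_sub_distrib, ← Finset.mul_sum, Finset.sum_ite_eq', Finset.mem_univ,
      if_true]
    ring
  have key : ∀ σ : ℝ, σ = 1 ∨ σ = -1 →
      l * (σ * (y p * wdeg A y p - y p * (2 * cliqueForm A 2 y))) ≤
      σ * (y p * cliqueForm A r (fun j => A p j * y j) -
        y p * (((r : ℝ) + 1) * cliqueForm A (r + 1) y)) := by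
    intro σ hσ
    have hz : ∀ i, HasDerivAt (fun ε : ℝ => y i * (1 + ε * (σ * ((if i = p then 1 else 0) - y p))))
        (y i * (σ * ((if i = p then 1 else 0) - y p))) 0 := by
      intro i
      simpa using (((hasDerivAt_id (0 : ℝ)).mul_const
        (σ * ((if i = p then 1 else 0) - y p))).const_add 1).const_mul (y i)
    refine h (fun _ => A)
      (fun ε i => y i * (1 + ε * (σ * ((if i = p then 1 else 0) - y p)))) _ _ rfl
      (by funext i; simp) ?_ ((hasDerivAt_cliqueForm hA.symm 1 hz).congr_deriv ?_)
      ((hasDerivAt_cliqueForm hA.symm r hz).congr_deriv ?_)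
    · intro ε h0 h1
      refine ⟨hA, fun i => mul_nonneg (hy i) ?_, ?_⟩
      · have hv : |σ * ((if i = p then 1 else 0) - y p)| ≤ 1 := by
          rw [abs_mul]
          have h2 : |σ| = 1 := by rcases hσ with rfl | rfl <;> simp
          rw [h2, one_mul, abs_le]
          have := hy p
          split_ifs <;> constructor <;> linarith
        nlinarith [(abs_le.1 hv).1]
      · have := hsum (fun _ => ε) σ
        simp only [mul_add, mul_one, Finset.sum_add_distrib, hy1]
        have e : ∑ i, y i * (ε * (σ * ((if i = p then 1 else 0) - y p))) =
            ∑ i, y i * (σ * ((if i = p then 1 else 0) - y p)) * ε :=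
          Finset.sum_congr rfl fun i _ => by ring
        rw [e, this, ← Finset.sum_mul, hy1]
        ring
    · simp only [zero_mul, add_zero, mul_one]
      rw [hsum, cliqueForm_two]
      simp only [cliqueForm_one, wdeg]
    · simp only [zero_mul, add_zero, mul_one]
      rw [hsum, succ_mul_cliqueForm]
  have h1 := key 1 (Or.inl rfl)
  have h2 := key (-1) (Or.inr rfl)
  linarith

theorem IsStationaryPair.row {r : ℕ} (h : IsStationaryPair (r + 1) A y l) (hA : IsWeight A)
    (hy : ∀ i, 0 ≤ y i) (hy1 : ∑ i, y i = 1) (p : ι) :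
    r * (y p * cliqueForm A r (fun j => A p j * y j)) ≤ l * (y p * wdeg A y p) := by
  classical
  have hu : ∀ (k : ℕ) (i : ι), HasDerivAt
      (fun ε : ℝ => (1 - ε * (if i = p then 1 else 0)) ^ k * y i)
      (if i = p then -(k : ℝ) * y i else 0) 0 := by
    intro k i
    have := ((((hasDerivAt_id (0 : ℝ)).mul_const
      (if i = p then (1 : ℝ) else 0)).const_sub 1).pow k).mul_const (y i)
    refine this.congr_deriv ?_
    split_ifs <;> simp
  have hder : ∀ k : ℕ, HasDerivAt (fun ε : ℝ => cliqueForm (fun i j =>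
      (1 - ε * (if i = p then 1 else 0)) * (1 - ε * (if j = p then 1 else 0)) * A i j) (k + 1) y)
      (-(k : ℝ) * y p * cliqueForm A k (fun j => A p j * y j)) 0 := by
    intro k
    have := hasDerivAt_cliqueForm hA.symm k (hu k)
    simp only [← cliqueForm_scale A _ k y] at this
    refine this.congr_deriv ?_
    simp
  have hle := h (fun ε i j =>
      (1 - ε * (if i = p then 1 else 0)) * (1 - ε * (if j = p then 1 else 0)) * A i j)
    (fun _ => y) _ _ (by funext i j; simp) rfl ?_ (hder 1) (hder r)
  · simp only [cliqueForm_one, Nat.cast_one] at hle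
    unfold wdeg
    linarith
  · intro ε h0 h1
    have hb : ∀ i, 0 ≤ 1 - ε * (if i = p then 1 else 0) ∧ 1 - ε * (if i = p then 1 else 0) ≤ 1 := by
      intro i; split_ifs <;> constructor <;> linarith
    refine ⟨⟨fun i => by rw [hA.diag, mul_zero], fun i j => ?_, fun i j => ?_, fun i j => ?_⟩,
      hy, hy1⟩
    · exact mul_nonneg (mul_nonneg (hb i).1 (hb j).1) (hA.nonneg i j)
    · exact mul_le_one₀ (mul_le_one₀ (hb i).2 (hb j).1 (hb j).2) (hA.nonneg i j) (hA.le_one i j)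
    · rw [hA.symm i j]; ring

theorem IsStationaryPair.weight (h : IsStationaryPair 3 A y l) (hA : IsWeight A)
    (hy : ∀ i, 0 ≤ y i) (hy1 : ∑ i, y i = 1) {s : ι → ι → ℝ} (hs : ∀ i j, s i j = s j i)
    (hs0 : ∀ i j, 0 ≤ s i j) (hs2 : ∀ i j, s i j ≤ 2) :
    0 ≤ ∑ i, ∑ j, A i j * (y i * y j) * (s i j * (l - codeg A y i j)) := by
  have hd2 : HasDerivAt (fun ε : ℝ => cliqueForm (fun i j => A i j * (1 - ε * s i j)) 2 y)
      (-(∑ i, ∑ j, A i j * (y i * y j) * s i j) / 2) 0 := by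
    have e : (fun ε : ℝ => cliqueForm (fun i j => A i j * (1 - ε * s i j)) 2 y) =
        fun ε => (∑ i, ∑ j, A i j * (1 - ε * s i j) * (y i * y j)) / 2 := by
      funext ε; rw [sum_pair_one]; ring
    rw [e]
    have h1 : ∀ i j, HasDerivAt (fun ε : ℝ => A i j * (1 - ε * s i j) * (y i * y j))
        (A i j * (-s i j) * (y i * y j)) 0 := by
      intro i j
      simpa using ((((hasDerivAt_id (0 : ℝ)).mul_const (s i j)).const_sub 1).const_mul
        (A i j)).mul_const (y i * y j)
    refine ((HasDerivAt.fun_sum fun i _ => HasDerivAt.fun_sum fun j _ => h1 i j).div_const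
      2).congr_deriv ?_
    rw [← Finset.sum_neg_distrib]
    congr 1
    refine Finset.sum_congr rfl fun i _ => ?_
    rw [← Finset.sum_neg_distrib]
    exact Finset.sum_congr rfl fun j _ => by ring
  have hd3 : HasDerivAt (fun ε : ℝ => cliqueForm (fun i j => A i j * (1 - ε * s i j)) 3 y)
      (-(∑ i, ∑ j, A i j * (y i * y j) * (s i j * codeg A y i j)) / 2) 0 := by
    have e : (fun ε : ℝ => cliqueForm (fun i j => A i j * (1 - ε * s i j)) 3 y) =
        fun ε => (∑ i, ∑ j, ∑ k, A i j * A j k * A i k * (y i * y j * y k) *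
          ((1 - ε * s i j) * (1 - ε * s j k) * (1 - ε * s i k))) / 6 := by
      funext ε
      rw [eq_div_iff (by norm_num), mul_comm, cliqueForm_three_eq_triSum, triSum]
      exact Finset.sum_congr rfl fun i _ => Finset.sum_congr rfl fun j _ =>
        Finset.sum_congr rfl fun k _ => by ring
    rw [e]
    have h0 : ∀ i j, HasDerivAt (fun ε : ℝ => 1 - ε * s i j) (-s i j) 0 := fun i j => by
      simpa using ((hasDerivAt_id (0 : ℝ)).mul_const (s i j)).const_sub 1
    have h1 : ∀ i j k, HasDerivAt (fun ε : ℝ => A i j * A j k * A i k * (y i * y j * y k) *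
          ((1 - ε * s i j) * (1 - ε * s j k) * (1 - ε * s i k)))
        (A i j * A j k * A i k * (y i * y j * y k) * (-s i j + (-s j k + -s i k))) 0 := by
      intro i j k
      refine ((((h0 i j).mul (h0 j k)).mul (h0 i k)).const_mul _).congr_deriv ?_
      simp only [Pi.mul_apply, zero_mul, sub_zero]
      ring
    refine ((HasDerivAt.fun_sum fun i _ => HasDerivAt.fun_sum fun j _ =>
      HasDerivAt.fun_sum fun k _ => h1 i j k).div_const 6).congr_deriv ?_
    have h2 : triSum A y (fun i j k => -s i j + (-s j k + -s i k)) =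
        -3 * ∑ i, ∑ j, A i j * (y i * y j) * (s i j * codeg A y i j) := by
      rw [triSum_add, triSum_add, ← triSum_swap_left hA (fun i j k => -s j k),
        ← triSum_swap_right hA (fun i j k => -s i k), ← triSum_pair,
        ← triSum_const_mul]
      rw [← triSum_add, ← triSum_add]
      congr 1
      funext i j k
      ring
    rw [triSum] at h2
    rw [h2]
    ring
  have hle := h (fun ε i j => A i j * (1 - ε * s i j)) (fun _ => y) _ _
    (by funext i j; simp) rfl ?_ hd2 hd3
  · have e : ∑ i, ∑ j, A i j * (y i * y j) * (s i j * (l - codeg A y i j)) =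
        l * (∑ i, ∑ j, A i j * (y i * y j) * s i j) -
          ∑ i, ∑ j, A i j * (y i * y j) * (s i j * codeg A y i j) := by
      simp only [Finset.mul_sum, ← Finset.sum_sub_distrib]
      exact Finset.sum_congr rfl fun i _ => Finset.sum_congr rfl fun j _ => by ring
    rw [e]
    linarith
  · intro ε h0 h1
    have hb : ∀ i j, 0 ≤ 1 - ε * s i j ∧ 1 - ε * s i j ≤ 1 := fun i j =>
      ⟨by nlinarith [hs0 i j, hs2 i j], by nlinarith [hs0 i j]⟩
    refine ⟨⟨fun i => by rw [hA.diag, zero_mul], fun i j => ?_, fun i j => ?_, fun i j => ?_⟩,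
      hy, hy1⟩
    · exact mul_nonneg (hA.nonneg i j) (hb i j).1
    · exact mul_le_one₀ (hA.le_one i j) (hb i j).1 (hb i j).2
    · rw [hA.symm i j, hs i j]

end FirstOrder

section LinkEstimate

theorem exists_scaled_root {m d e : ℝ} (hm : 0 < m) (hd : 0 < d)
    (h1 : (m - 1) * d ^ 2 ≤ 2 * m * e) (h2 : 2 * (m + 1) * e ≤ m * d ^ 2) :
    ∃ w, 0 < w ∧ m * w ≤ d ∧ d ≤ (m + 1) * w ∧ e = m * w * d - m * (m + 1) / 2 * w ^ 2 := by
  have h3 : edgePoly m (1 / m) ≤ e / d ^ 2 := by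
    rw [show edgePoly m (1 / m) = (m - 1) / (2 * m) by unfold edgePoly; field_simp; ring,
      div_le_div_iff₀ (by positivity) (by positivity)]
    linarith
  have h4 : e / d ^ 2 ≤ edgePoly m (1 / (m + 1)) := by
    rw [show edgePoly m (1 / (m + 1)) = m / (2 * (m + 1)) by unfold edgePoly; field_simp; ring,
      div_le_div_iff₀ (by positivity) (by positivity)]
    linarith
  obtain ⟨u, hu1, hu2, hu⟩ := exists_edgePoly_eq hm h3 h4
  have hu0 : 0 < u := lt_of_lt_of_le (by positivity) hu1
  rw [div_le_iff₀ (by positivity)] at hu1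
  rw [le_div_iff₀ hm] at hu2
  rw [div_eq_iff (by positivity)] at hu
  refine ⟨u * d, by positivity, by nlinarith, by nlinarith, ?_⟩
  rw [hu, edgePoly]
  ring

/-- Monotonicity of the Goodman bound, in quantitative form. -/
theorem goodman_shift {m d e e₁ q : ℝ} (hm : 1 ≤ m) (he : e ≤ e₁)
    (he₁ : 2 * m * e₁ ≤ (m - 1) * d ^ 2) (hq : e * (4 * e - d ^ 2) ≤ 3 * d * q) :
    m * (e₁ * (4 * e₁ - d ^ 2)) ≤ 3 * d * (m * q + (m - 1) * d * (e₁ - e)) := by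
  nlinarith [mul_le_mul_of_nonneg_left hq (by linarith : (0 : ℝ) ≤ m),
    mul_nonneg (sub_nonneg.2 he) (by nlinarith [sq_nonneg d] :
      0 ≤ 3 * (m - 1) * d ^ 2 - m * (4 * (e₁ + e) - d ^ 2))]

theorem secant_bound {m w x d : ℝ} (hm : 1 ≤ m)
    (h : 3 * d ≤ (m + 1) * (w + 2 * x)) :
    m * (m - 1) / 2 * x ^ 2 * d - (m + 1) * m * (m - 1) / 3 * x ^ 3 ≤
      m * (m - 1) / 2 * w ^ 2 * d - (m + 1) * m * (m - 1) / 3 * w ^ 3 +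
      (m - 1) * w * ((m * x * d - m * (m + 1) / 2 * x ^ 2) -
        (m * w * d - m * (m + 1) / 2 * w ^ 2)) := by
  have h1 : 0 ≤ m * (m - 1) * (w - x) ^ 2 * ((m + 1) * (w + 2 * x) - 3 * d) :=
    mul_nonneg (mul_nonneg (mul_nonneg (by linarith) (by linarith)) (sq_nonneg _)) (by linarith)
  nlinarith [h1]

theorem link_bound {m x d e q D : ℝ} (hm : 2 ≤ m) (hx : 0 < x)
    (hx1 : 1 ≤ (m + 2) * x) (hd0 : 0 ≤ d) (hd1 : d ≤ 1) (he : 0 ≤ e) (hD : 0 < D)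
    (heq : e = m * x * d - m * (m + 1) / 2 * x ^ 2 - D) (h2e : 2 * e ≤ m * x * d)
    (hG : e * (4 * e - d ^ 2) ≤ 3 * d * q)
    (hP : ∀ w, 0 < w → m * w ≤ d → d ≤ (m + 1) * w → e = m * w * d - m * (m + 1) / 2 * w ^ 2 →
      m * (m - 1) / 2 * w ^ 2 * d - (m + 1) * m * (m - 1) / 3 * w ^ 3 ≤ q) :
    m * (m * (m - 1) / 2 * x ^ 2 * d - (m + 1) * m * (m - 1) / 3 * x ^ 3) ≤
      m * q + (m - 1) * d * D := by
  have hd : 0 < d := by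
    rcases hd0.eq_or_lt with h | h
    · rw [← h] at heq
      have : 0 < m * (m + 1) / 2 * x ^ 2 := by positivity
      linarith
    · exact h
  rcases le_total ((m - 1) * d ^ 2) (2 * m * e) with hc | hc
  · obtain ⟨w, hw0, hw1, hw2, hew⟩ := exists_scaled_root (by linarith : 0 < m) hd hc (by
      nlinarith [sq_nonneg (d - (m + 1) * x)])
    have hq := hP w hw0 hw1 hw2 hew
    have hxw : x ≤ w := by
      by_contra hlt
      push Not at hlt
      nlinarith [mul_pos (by linarith : 0 < m) (sub_pos.2 hlt)]
    have hw2x : w ≤ 2 * x := by nlinarith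
    have hb := secant_bound (by linarith : 1 ≤ m) (x := x) (w := w) (d := d) (by
      have h1 : d * (2 * w - x) ≤ (m + 1) * w ^ 2 := by
        have : m * (d * (2 * w - x)) ≤ m * ((m + 1) * w ^ 2) := by rw [hew] at h2e; linarith
        exact le_of_mul_le_mul_left this (by linarith)
      have h2 : 0 ≤ (m + 1) * ((w - x) * (2 * x - w)) :=
        mul_nonneg (by linarith) (mul_nonneg (by linarith) (by linarith))
      refine le_of_mul_le_mul_right ?_ (by linarith : 0 < 2 * w - x)
      nlinarith)
    rw [← hew] at hb
    have hD' : m * x * d - m * (m + 1) / 2 * x ^ 2 - e = D := by linarith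
    rw [hD'] at hb
    have := mul_le_mul_of_nonneg_left hw1 (mul_nonneg (by linarith : 0 ≤ m - 1) hD.le)
    nlinarith [mul_le_mul_of_nonneg_left hb (by linarith : 0 ≤ m),
      mul_le_mul_of_nonneg_left hq (by linarith : 0 ≤ m)]
  · refine le_of_mul_le_mul_left ?_ (by linarith : 0 < 3 * d)
    rcases le_total d (m * x) with hA | hA
    · have h1 := goodman_shift (e₁ := m * x * d - m * (m + 1) / 2 * x ^ 2) (by linarith : 1 ≤ m)
        (by linarith) (by
          nlinarith [mul_nonneg (sub_nonneg.2 hA)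
            (by nlinarith : 0 ≤ m * (m + 1) * x - (m - 1) * d)]) hG
      have h2 : 0 ≤ m * x * (m * x - d) * (d - (m + 1) * x) ^ 2 :=
        mul_nonneg (mul_nonneg (by positivity) (sub_nonneg.2 hA)) (sq_nonneg _)
      rw [show m * x * d - m * (m + 1) / 2 * x ^ 2 - e = D by linarith] at h1
      nlinarith [mul_nonneg (by linarith : 0 ≤ m) h2]
    · rcases le_total ((m - 1) * d) (m ^ 2 * x) with hB | hB
      · obtain ⟨w, rfl⟩ : ∃ w, d = m * w := ⟨d / m, by field_simp⟩
        have hxw : x ≤ w := le_of_mul_le_mul_left hA (by linarith)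
        have hB' : (m - 1) * w ≤ m * x :=
          le_of_mul_le_mul_left (by linarith : m * ((m - 1) * w) ≤ m * (m * x)) (by linarith)
        have h1 := goodman_shift (e₁ := m * (m - 1) / 2 * w ^ 2) (by linarith : 1 ≤ m)
          (by refine le_of_mul_le_mul_left ?_ (by linarith : 0 < 2 * m); linarith)
          (by linarith) hG
        have hb := secant_bound (by linarith : 1 ≤ m) (x := x) (w := w) (d := m * w) (by
          nlinarith [mul_nonneg (by linarith : 0 ≤ m - 2) hx.le])
        have hw : 0 < w := by nlinarith
        have h3 := mul_le_mul_of_nonneg_left hb (by positivity : 0 ≤ 3 * (m * w) * m)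
        rw [heq] at h1
        linarith
      · have h1 := goodman_shift (e₁ := m * x * d / 2) (by linarith : 1 ≤ m)
          (by linarith) (by nlinarith) hG
        have h2 : 0 ≤ (d - (m + 1) * x) * ((2 * m - 3) * d - 2 * m * (m - 1) * x) := by
          refine mul_nonneg ?_ ?_
          · have : (m - 1) * ((m + 1) * x) ≤ (m - 1) * d := by nlinarith
            linarith [le_of_mul_le_mul_left this (by linarith)]
          · have : (m - 1) * (2 * m * (m - 1) * x) ≤ (m - 1) * ((2 * m - 3) * d) := by
              have h5 := mul_le_mul_of_nonneg_left hB (by linarith : 0 ≤ 2 * m - 3)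
              nlinarith [mul_nonneg (mul_nonneg (by linarith : 0 ≤ m) (by linarith : 0 ≤ m - 2))
                hx.le]
            linarith [le_of_mul_le_mul_left this (by linarith)]
        have h3 := mul_nonneg (by positivity : 0 ≤ m * d * x) h2
        rw [heq] at h1
        nlinarith

end LinkEstimate

section CliqueThree

variable {ι : Type*} [Fintype ι]

/-- The homogeneous form of the lower bound for `K_3` in terms of `K_2` on the interval where the
extremal vector has `t` large coordinates. -/
def CliqueThreeBound (ι : Type*) [Fintype ι] (t : ℝ) : Prop :=
  ∀ (A : ι → ι → ℝ) (y : ι → ℝ) (x : ℝ), IsWeight A → (∀ i, 0 ≤ y i) → 0 ≤ x →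
    t * x ≤ ∑ i, y i → ∑ i, y i ≤ (t + 1) * x →
    cliqueForm A 2 y = t * x * (∑ i, y i) - t * (t + 1) / 2 * x ^ 2 →
    t * (t - 1) / 2 * x ^ 2 * (∑ i, y i) - (t + 1) * t * (t - 1) / 3 * x ^ 3 ≤ cliqueForm A 3 y

theorem cliqueThreeBound_of_sum_one {t : ℝ} (ht : 0 < t)
    (h : ∀ (A : ι → ι → ℝ) (y : ι → ℝ) (x : ℝ), IsWeight A → (∀ i, 0 ≤ y i) → ∑ i, y i = 1 →
      1 / (t + 1) ≤ x → x ≤ 1 / t → cliqueForm A 2 y = edgePoly t x →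
      t * (t - 1) / 2 * x ^ 2 - (t + 1) * t * (t - 1) / 3 * x ^ 3 ≤ cliqueForm A 3 y) :
    CliqueThreeBound ι t := by
  intro A y x hA hy hx h1 h2 h3
  rcases (Finset.sum_nonneg fun i _ => hy i : 0 ≤ ∑ i, y i).eq_or_lt with h0 | h0
  · rw [← h0] at h1
    have hx0 : x = 0 := by nlinarith
    subst hx0
    simpa using cliqueForm_nonneg hA 3 y hy
  · set d := ∑ i, y i with hd
    have key := h A (fun i => d⁻¹ * y i) (x / d) hA
      (fun i => mul_nonneg (inv_nonneg.2 h0.le) (hy i))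
      (by rw [← Finset.mul_sum, ← hd, inv_mul_cancel₀ h0.ne'])
      (by rw [div_le_div_iff₀ (by linarith) h0]; linarith)
      (by rw [div_le_div_iff₀ h0 ht]; linarith)
      (by rw [cliqueForm_smul, h3, edgePoly]; field_simp)
    rw [cliqueForm_smul, inv_pow, inv_mul_eq_div, le_div_iff₀ (by positivity)] at key
    refine le_trans (le_of_eq ?_) key
    field_simp

theorem cliqueForm_three_ge_of_endpoint {A : ι → ι → ℝ} {y : ι → ℝ} {t : ℝ} (ht : 0 < t)
    (hA : IsWeight A) (hy : ∀ i, 0 ≤ y i) (hy1 : ∑ i, y i = 1) {x : ℝ}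
    (hx : x = 1 / t ∨ x = 1 / (t + 1)) (hc : cliqueForm A 2 y = edgePoly t x) :
    t * (t - 1) / 2 * x ^ 2 - (t + 1) * t * (t - 1) / 3 * x ^ 3 ≤ cliqueForm A 3 y := by
  have h := goodman hA hy
  rw [hy1, hc] at h
  have e : edgePoly t x * (4 * edgePoly t x - 1) =
      3 * (t * (t - 1) / 2 * x ^ 2 - (t + 1) * t * (t - 1) / 3 * x ^ 3) := by
    unfold edgePoly
    rcases hx with rfl | rfl <;> field_simp <;> ring
  linarith

theorem wdeg_le_one {A : ι → ι → ℝ} {y : ι → ℝ} (hA : IsWeight A) (hy : ∀ i, 0 ≤ y i)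
    (hy1 : ∑ i, y i = 1) (i : ι) : wdeg A y i ≤ 1 := by
  rw [← hy1]
  exact Finset.sum_le_sum fun j _ => mul_le_of_le_one_left (hy j) (hA.le_one i j)

theorem wdeg_nonneg {A : ι → ι → ℝ} {y : ι → ℝ} (hA : IsWeight A) (hy : ∀ i, 0 ≤ y i)
    (i : ι) : 0 ≤ wdeg A y i :=
  Finset.sum_nonneg fun j _ => mul_nonneg (hA.nonneg i j) (hy j)

theorem codeg_le_wdeg {A : ι → ι → ℝ} {y : ι → ℝ} (hA : IsWeight A) (hy : ∀ i, 0 ≤ y i)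
    (i j : ι) : codeg A y i j ≤ wdeg A y i := by
  refine Finset.sum_le_sum fun l _ => mul_le_mul_of_nonneg_right ?_ (hy l)
  exact mul_le_of_le_one_right (hA.nonneg i l) (hA.le_one j l)

theorem CliqueThreeBound.step {m : ℝ} (hm : m = 1 ∨ 2 ≤ m) (hP : CliqueThreeBound ι m) :
    CliqueThreeBound ι (m + 1) := by
  have hm1 : 1 ≤ m := by rcases hm with h | h <;> linarith
  refine cliqueThreeBound_of_sum_one (by linarith) ?_
  intro A₀ y₀ x₀ hA₀ hy₀ hs₀ hx₀ hx₀' hc₀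
  by_contra hlt
  push Not at hlt
  obtain ⟨A, y, x, hA, hy, hy1, hx1, hx2, hc, hlt, hst⟩ := exists_stationary (ι := ι) 3
    (t := m + 1) (by linarith)
    (F := fun x => (m + 1) * (m + 1 - 1) / 2 * x ^ 2 -
      (m + 1 + 1) * (m + 1) * (m + 1 - 1) / 3 * x ^ 3) (Λ := fun x => m * x)
    (fun x => by
      refine (((hasDerivAt_pow 2 x).const_mul _).sub
        ((hasDerivAt_pow 3 x).const_mul _)).congr_deriv ?_
      norm_num
      ring)
    (fun A y hA hy hy1 x hx hc => cliqueForm_three_ge_of_endpoint (by linarith) hA hy hy1 hx hc)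
    hA₀ hy₀ hs₀ hx₀ hx₀' hc₀ hlt
  have hx : 0 < x := lt_trans (by positivity) hx1
  rw [div_lt_iff₀ (by positivity)] at hx1
  rw [lt_div_iff₀ (by positivity)] at hx2
  obtain ⟨δ, hδ, hK3⟩ : ∃ δ, 0 < δ ∧ cliqueForm A 3 y = (m + 1) * m / 2 * x ^ 2 -
      (m + 2) * (m + 1) * m / 3 * x ^ 3 - δ :=
    ⟨_, sub_pos.2 hlt, by ring⟩
  have hvert : ∀ i, y i * cliqueForm A 2 (fun j => A i j * y j) =
      y i * (m * x * wdeg A y i + (-(m * (m + 1) / 2 * x ^ 2) - 3 * δ)) := by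
    intro i
    rw [hst.vertex hA hy hy1 i, hc, hK3, edgePoly]
    push_cast
    ring
  have hlink : ∀ i, y i * (m * (m * (m - 1) / 2 * x ^ 2 * wdeg A y i -
      (m + 1) * m * (m - 1) / 3 * x ^ 3)) ≤
      y i * (m * cliqueForm A 3 (fun j => A i j * y j) + (m - 1) * wdeg A y i * (3 * δ)) := by
    intro i
    have hyi : ∀ j, 0 ≤ A i j * y j := fun j => mul_nonneg (hA.nonneg i j) (hy j)
    rcases (hy i).eq_or_lt with h0 | h0
    · rw [← h0, zero_mul, zero_mul]
    refine mul_le_mul_of_nonneg_left ?_ h0.le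
    rcases hm with rfl | hm
    · simpa using cliqueForm_nonneg hA 3 _ hyi
    have hrow := hst.row hA hy hy1 i
    push_cast at hrow
    refine link_bound hm hx (by linarith) (wdeg_nonneg hA hy i) (wdeg_le_one hA hy hy1 i)
      (cliqueForm_nonneg hA 2 _ hyi) (by linarith : 0 < 3 * δ) ?_ ?_ (goodman hA hyi)
      (fun w hw h1 h2 h3 => hP A _ w hA hyi hw.le h1 h2 h3)
    · linarith [mul_left_cancel₀ h0.ne' (hvert i)]
    · refine le_of_mul_le_mul_left ?_ h0
      linarith
  have hsum := Finset.sum_le_sum fun i (_ : i ∈ Finset.univ) => hlink i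
  have e1 : ∑ i, y i * (m * (m * (m - 1) / 2 * x ^ 2 * wdeg A y i -
      (m + 1) * m * (m - 1) / 3 * x ^ 3)) = m * (m * (m - 1) / 2 * x ^ 2 *
      (2 * cliqueForm A 2 y) - (m + 1) * m * (m - 1) / 3 * x ^ 3) := by
    have : ∀ i, y i * (m * (m * (m - 1) / 2 * x ^ 2 * wdeg A y i -
      (m + 1) * m * (m - 1) / 3 * x ^ 3)) = m * (m * (m - 1) / 2 * x ^ 2) * (y i * wdeg A y i) -
      m * ((m + 1) * m * (m - 1) / 3 * x ^ 3) * y i := fun i => by ring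
    simp only [this, Finset.sum_sub_distrib, ← Finset.mul_sum, ← cliqueForm_two, hy1]
    ring
  have e2 : ∑ i, y i * (m * cliqueForm A 3 (fun j => A i j * y j) +
      (m - 1) * wdeg A y i * (3 * δ)) =
      m * (4 * cliqueForm A 4 y) + (m - 1) * (3 * δ) * (2 * cliqueForm A 2 y) := by
    have : ∀ i, y i * (m * cliqueForm A 3 (fun j => A i j * y j) +
      (m - 1) * wdeg A y i * (3 * δ)) = m * (y i * cliqueForm A 3 (fun j => A i j * y j)) +
      (m - 1) * (3 * δ) * (y i * wdeg A y i) := fun i => by ring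
    simp only [this, Finset.sum_add_distrib, ← Finset.mul_sum, ← cliqueForm_two, ← cliqueForm_four]
  rw [e1, e2] at hsum
  have hupper := cliqueForm_four_le hA hy hy1 hvert (by
    have h := hst.weight hA hy hy1 (s := fun i j => codeg A y i j - wdeg A y i - wdeg A y j + 1)
      (fun i j => ?_) (fun i j => ?_) (fun i j => ?_)
    · exact h
    · have : codeg A y i j = codeg A y j i :=
        Finset.sum_congr rfl fun l _ => by ring
      rw [this]; ring
    · rw [← hy1]; exact codeg_lower hA hy i j
    · linarith [codeg_le_wdeg hA hy i j, wdeg_nonneg hA hy j])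
  have hupper := mul_le_mul_of_nonneg_left hupper (by linarith : 0 ≤ m)
  rw [hK3, hc, edgePoly] at hupper
  rw [hc, edgePoly] at hsum
  have hfin : δ * (m * (3 * m * x - 2) + 6 * ((m + 1) * x - (m + 1) * (m + 2) / 2 * x ^ 2)) ≤ 0 := by
    linarith
  have hpos : 0 < m * (3 * m * x - 2) + 6 * ((m + 1) * x - (m + 1) * (m + 2) / 2 * x ^ 2) := by
    have h1 : 0 < (1 - (m + 1) * x) * ((m + 2) * x - 1) :=
      mul_pos (by linarith) (by linarith)
    have h2 : 0 < (3 * m ^ 2 - 3) * x + 3 - 2 * m := by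
      have : 0 ≤ (3 * m ^ 2 - 3) * ((m + 2) * x - 1) :=
        mul_nonneg (by nlinarith) (by linarith)
      refine pos_of_mul_pos_right (a := m + 2) ?_ (by linarith)
      nlinarith
    linarith
  linarith [mul_pos hδ hpos]

theorem cliqueThreeBound (ι : Type*) [Fintype ι] (n : ℕ) : CliqueThreeBound ι ((n : ℝ) + 1) := by
  induction n with
  | zero =>
    intro A y x hA hy _ _ _ _
    simpa using cliqueForm_nonneg hA 3 y hy
  | succ n ih =>
    push_cast
    refine ih.step ?_
    rcases Nat.eq_zero_or_pos n with rfl | hn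
    · left; simp
    · right
      have : (1 : ℝ) ≤ n := by exact_mod_cast hn
      linarith

end CliqueThree

section CliqueFour

variable {ι : Type*} [Fintype ι]

theorem link_edge_lt {m x d e q D : ℝ} (hm : 2 ≤ m) (hx : 0 < x)
    (hx1 : 1 ≤ (m + 2) * x) (hd0 : 0 ≤ d) (hd1 : d ≤ 1) (hq0 : 0 ≤ q) (hD : 0 < D)
    (hq : q = m * (m - 1) / 2 * x ^ 2 * d - (m + 1) * m * (m - 1) / 3 * x ^ 3 - D)
    (h3q : 3 * q ≤ m * (m - 1) / 2 * x ^ 2 * d)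
    (hG : e * (4 * e - d ^ 2) ≤ 3 * d * q)
    (hP : ∀ w, 0 < w → m * w ≤ d → d ≤ (m + 1) * w → e = m * w * d - m * (m + 1) / 2 * w ^ 2 →
      m * (m - 1) / 2 * w ^ 2 * d - (m + 1) * m * (m - 1) / 3 * w ^ 3 ≤ q) :
    e < m * x * d - m * (m + 1) / 2 * x ^ 2 := by
  by_contra! hle
  have hmm : 0 < m * (m - 1) := mul_pos (by linarith) (by linarith)
  have h3d : 2 * (m + 1) * x < 3 * d := by
    have h : 0 < m * (m - 1) * x ^ 2 * (3 * d - 2 * (m + 1) * x) := by linarith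
    linarith [pos_of_mul_pos_right h (by positivity)]
  have hd : 0 < d := by linarith [(by positivity : 0 < 2 * (m + 1) * x)]
  rcases le_total (m * d ^ 2) (2 * (m + 1) * e) with ha | ha
  · obtain ⟨v, rfl⟩ : ∃ v, d = (m + 1) * v := ⟨d / (m + 1), by field_simp⟩
    have hv : 0 < v := pos_of_mul_pos_right hd (by linarith)
    have he : m * (m + 1) / 2 * v ^ 2 ≤ e := by
      refine le_of_mul_le_mul_left ?_ (by linarith : 0 < 2 * (m + 1)); linarith
    have h1 : m * (m + 1) / 2 * v ^ 2 * ((m + 1) * (m - 1) * v ^ 2) ≤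
        e * (4 * e - ((m + 1) * v) ^ 2) := by
      refine mul_le_mul he (by linarith) ?_ (by linarith [(by positivity : 0 ≤ m * (m + 1) * v ^ 2)])
      have : 0 ≤ m - 1 := by linarith
      positivity
    have h2 : (m + 1) * v * ((m + 1) * (m * (m - 1)) * v ^ 3 / 2) ≤ (m + 1) * v * (3 * q) := by
      linarith
    have h3 := le_of_mul_le_mul_left h2 hd
    have h4 : 0 ≤ (m + 1) * (m * (m - 1)) * ((v - x) ^ 2 * (v + 2 * x)) := by positivity
    linarith
  rcases le_total ((m - 1) * d ^ 2) (2 * m * e) with hb | hb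
  · obtain ⟨w, hw0, hw1, hw2, hew⟩ := exists_scaled_root (by linarith : 0 < m) hd hb ha
    have hqw := hP w hw0 hw1 hw2 hew
    have h1 : 0 ≤ (w - x) * (2 * d - (m + 1) * (w + x)) := by
      have : 0 ≤ m * ((w - x) * (2 * d - (m + 1) * (w + x))) := by rw [hew] at hle; linarith
      exact nonneg_of_mul_nonneg_right this (by linarith)
    have h2 : 0 < (w - x) * (2 * (m + 1) * (w ^ 2 + w * x + x ^ 2) - 3 * (w + x) * d) := by
      have : 0 < m * (m - 1) *
        ((w - x) * (2 * (m + 1) * (w ^ 2 + w * x + x ^ 2) - 3 * (w + x) * d)) := by linarith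
      exact pos_of_mul_pos_right this hmm.le
    rcases lt_trichotomy w x with hwx | rfl | hwx
    · have h3 := nonpos_of_mul_nonneg_right h1 (by linarith)
      have h4 := neg_of_mul_pos_right h2 (by linarith)
      have h5 : 0 ≤ (m + 1) * (w - x) ^ 2 := by positivity
      linarith [mul_nonneg (by linarith : 0 ≤ w + x) (neg_nonneg.2 h3)]
    · simp at h2
    · have h3 : 0 ≤ 2 * d - (m + 1) * (w + x) := nonneg_of_mul_nonneg_right h1 (by linarith)
      have h4 : (3 * w ^ 2 - x ^ 2) * d ≤ 2 * (m + 1) * w ^ 3 := by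
        have : m * (m - 1) * ((3 * w ^ 2 - x ^ 2) * d) ≤ m * (m - 1) * (2 * (m + 1) * w ^ 3) := by
          linarith
        exact le_of_mul_le_mul_left this hmm
      have hw2x : w ≤ 2 * x := by
        have := mul_nonneg (sub_nonneg.2 hm) hx.le
        exact le_of_mul_le_mul_left (by linarith : m * w ≤ m * (2 * x)) (by linarith)
      have h5 : 0 ≤ (3 * w ^ 2 - x ^ 2) * (2 * d - (m + 1) * (w + x)) :=
        mul_nonneg (by linarith [pow_le_pow_left₀ hx.le hwx.le 2, sq_nonneg w]) h3
      have h6 : 0 < (m + 1) * ((w - x) * (w * (2 * x - w) + x ^ 2)) :=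
        mul_pos (by linarith) (mul_pos (by linarith)
          (add_pos_of_nonneg_of_pos (mul_nonneg hw0.le (by linarith)) (by positivity)))
      linarith
  · have h1 : 0 ≤ (m * x - d) * (m * (m + 1) * x - (m - 1) * d) := by
      have := mul_le_mul_of_nonneg_left hle (by linarith : 0 ≤ 2 * m)
      linarith
    have h2 : 0 < m * (m + 1) * x - (m - 1) * d := by
      have := mul_le_mul_of_nonneg_left (hd1.trans hx1) (by linarith : 0 ≤ m - 1)
      linarith
    have h3 : 0 ≤ m * x - d := nonneg_of_mul_nonneg_left h1 h2
    set f := m * x * d - m * (m + 1) / 2 * x ^ 2 with hf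
    have h4 : 0 ≤ 4 * f - d ^ 2 := by
      have h5 : 0 ≤ (m * x - d) * (3 * d - 2 * (m + 1) * x) := mul_nonneg h3 (by linarith)
      have h6 : 0 ≤ (7 * m - 2) * x * (3 * d - 2 * (m + 1) * x) :=
        mul_nonneg (mul_nonneg (by linarith) hx.le) (by linarith)
      have h7 : 0 ≤ (m - 2) * (m + 1) * x ^ 2 :=
        mul_nonneg (mul_nonneg (by linarith) (by linarith)) (sq_nonneg x)
      linarith
    have h5 : f * (4 * f - d ^ 2) ≤ e * (4 * e - d ^ 2) :=
      mul_le_mul hle (by linarith) h4 (by nlinarith [sq_nonneg d])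
    have h6 : 0 ≤ m * x * (m * x - d) * (d - (m + 1) * x) ^ 2 :=
      mul_nonneg (mul_nonneg (by positivity) h3) (sq_nonneg _)
    have h7 := mul_pos hd hD
    rw [hq, hf] at *
    linarith

theorem cliqueForm_four_ge_of_endpoint {A : ι → ι → ℝ} {y : ι → ℝ} {t : ℝ} (ht : 3 ≤ t)
    (hA : IsWeight A) (hy : ∀ i, 0 ≤ y i) (hy1 : ∑ i, y i = 1) {x : ℝ}
    (hx : x = 1 / t ∨ x = 1 / (t + 1)) (hc : cliqueForm A 2 y = edgePoly t x) :
    t * (t - 1) * (t - 2) / 6 * x ^ 3 - (t + 1) * t * (t - 1) * (t - 2) / 8 * x ^ 4 ≤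
      cliqueForm A 4 y := by
  have ht0 : 0 < t := by linarith
  have h3 := cliqueForm_three_ge_of_endpoint ht0 hA hy hy1 hx hc
  have hmm := moon_moser hA hy hy1
  rw [hc] at hmm
  obtain ⟨s, hs, hx⟩ : ∃ s, 3 ≤ s ∧ edgePoly t x = (s - 1) / (2 * s) ∧
      t * (t - 1) / 2 * x ^ 2 - (t + 1) * t * (t - 1) / 3 * x ^ 3 =
        (s - 1) * (s - 2) / (6 * s ^ 2) ∧
      t * (t - 1) * (t - 2) / 6 * x ^ 3 - (t + 1) * t * (t - 1) * (t - 2) / 8 * x ^ 4 =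
        (s - 1) * (s - 2) * (s - 3) / (24 * s ^ 3) := by
    unfold edgePoly
    rcases hx with rfl | rfl
    · exact ⟨t, ht, by field_simp; ring, by field_simp; ring, by field_simp; ring⟩
    · exact ⟨t + 1, by linarith, by field_simp; ring, by field_simp; ring, by field_simp; ring⟩
  obtain ⟨e1, e2, e3⟩ := hx
  rw [e1] at hmm
  rw [e2] at h3
  rw [e3]
  have hs1 : 0 < s - 1 := by linarith
  have hs2 : 0 < s - 2 := by linarith
  have hs3 : 0 ≤ s - 3 := by linarith
  have hs0 : 0 < s := by linarith
  have h9 : 0 ≤ 9 * ((s - 1) * (s - 2) / (6 * s ^ 2)) - (s - 1) / (2 * s) := by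
    rw [show 9 * ((s - 1) * (s - 2) / (6 * s ^ 2)) - (s - 1) / (2 * s) =
      (s - 1) * (s - 3) / s ^ 2 by field_simp; ring]
    positivity
  have h := (mul_le_mul h3 (by linarith :
    9 * ((s - 1) * (s - 2) / (6 * s ^ 2)) - (s - 1) / (2 * s) ≤
      9 * cliqueForm A 3 y - (s - 1) / (2 * s)) h9 (cliqueForm_nonneg hA 3 y hy)).trans hmm
  refine le_of_mul_le_mul_left (le_trans (le_of_eq ?_) h)
    (by positivity : 0 < 8 * ((s - 1) / (2 * s)))
  field_simp
  ring

theorem cliqueForm_four_ge {m : ℝ} (hm : 2 ≤ m) (hP : CliqueThreeBound ι m)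
    {A₀ : ι → ι → ℝ} {y₀ : ι → ℝ} {x₀ : ℝ} (hA₀ : IsWeight A₀) (hy₀ : ∀ i, 0 ≤ y₀ i)
    (hs₀ : ∑ i, y₀ i = 1) (hx₀ : 1 / (m + 1 + 1) ≤ x₀) (hx₀' : x₀ ≤ 1 / (m + 1))
    (hc₀ : cliqueForm A₀ 2 y₀ = edgePoly (m + 1) x₀) :
    (m + 1) * (m + 1 - 1) * (m + 1 - 2) / 6 * x₀ ^ 3 -
      (m + 1 + 1) * (m + 1) * (m + 1 - 1) * (m + 1 - 2) / 8 * x₀ ^ 4 ≤ cliqueForm A₀ 4 y₀ := by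
  by_contra! hlt
  obtain ⟨A, y, x, hA, hy, hy1, hx1, hx2, hc, hlt, hst⟩ := exists_stationary (ι := ι) 4
    (t := m + 1) (by linarith)
    (F := fun x => (m + 1) * (m + 1 - 1) * (m + 1 - 2) / 6 * x ^ 3 -
      (m + 1 + 1) * (m + 1) * (m + 1 - 1) * (m + 1 - 2) / 8 * x ^ 4)
    (Λ := fun x => m * (m - 1) / 2 * x ^ 2)
    (fun x => by
      refine (((hasDerivAt_pow 3 x).const_mul _).sub
        ((hasDerivAt_pow 4 x).const_mul _)).congr_deriv ?_
      norm_num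
      ring)
    (fun A y hA hy hy1 x hx hc => cliqueForm_four_ge_of_endpoint (by linarith) hA hy hy1 hx hc)
    hA₀ hy₀ hs₀ hx₀ hx₀' hc₀ hlt
  have hx : 0 < x := lt_trans (by positivity) hx1
  rw [div_lt_iff₀ (by positivity)] at hx1
  rw [lt_div_iff₀ (by positivity)] at hx2
  obtain ⟨δ, hδ, hK4⟩ : ∃ δ, 0 < δ ∧ cliqueForm A 4 y = (m + 1) * m * (m - 1) / 6 * x ^ 3 -
      (m + 2) * (m + 1) * m * (m - 1) / 8 * x ^ 4 - δ :=
    ⟨_, sub_pos.2 hlt, by ring⟩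
  have hK3 := hP.step (Or.inr hm) A y x hA hy hx.le (by rw [hy1]; linarith)
    (by rw [hy1]; linarith) (by rw [hc, hy1, edgePoly]; ring)
  have hedge : ∀ i, 0 < y i → cliqueForm A 2 (fun j => A i j * y j) <
      m * x * wdeg A y i - m * (m + 1) / 2 * x ^ 2 := by
    intro i h0
    have hyi : ∀ j, 0 ≤ A i j * y j := fun j => mul_nonneg (hA.nonneg i j) (hy j)
    have hvert := mul_left_cancel₀ h0.ne' (hst.vertex hA hy hy1 i)
    have hrow := hst.row hA hy hy1 i
    push_cast at hvert hrow
    refine link_edge_lt (D := 4 * δ) hm hx (by linarith) (wdeg_nonneg hA hy i)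
      (wdeg_le_one hA hy hy1 i)
      (cliqueForm_nonneg hA 3 _ hyi) (by linarith) ?_ ?_ (goodman hA hyi)
      (fun w hw h1 h2 h3 => hP A _ w hA hyi hw.le h1 h2 h3)
    · rw [hvert, hK4, hc, edgePoly]
      ring
    · refine le_of_mul_le_mul_left ?_ h0
      linarith
  have hsum : ∑ i, y i * cliqueForm A 2 (fun j => A i j * y j) <
      ∑ i, y i * (m * x * wdeg A y i - m * (m + 1) / 2 * x ^ 2) := by
    refine Finset.sum_lt_sum (fun i _ => ?_) ?_
    · rcases (hy i).eq_or_lt with h0 | h0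
      · rw [← h0, zero_mul, zero_mul]
      · exact mul_le_mul_of_nonneg_left (hedge i h0).le h0.le
    · obtain ⟨i, hi, h0⟩ := Finset.exists_lt_of_sum_lt
        (s := Finset.univ) (f := fun _ : ι => (0 : ℝ)) (g := y) (by simp [hy1])
      exact ⟨i, hi, mul_lt_mul_of_pos_left (hedge i h0) h0⟩
  have e : ∑ i, y i * (m * x * wdeg A y i - m * (m + 1) / 2 * x ^ 2) =
      m * x * (2 * cliqueForm A 2 y) - m * (m + 1) / 2 * x ^ 2 := by
    have : ∀ i, y i * (m * x * wdeg A y i - m * (m + 1) / 2 * x ^ 2) =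
      m * x * (y i * wdeg A y i) - m * (m + 1) / 2 * x ^ 2 * y i := fun i => by ring
    simp only [this, Finset.sum_sub_distrib, ← Finset.mul_sum, ← cliqueForm_two, hy1, mul_one]
  rw [e, ← cliqueForm_three, hc, edgePoly] at hsum
  rw [hy1] at hK3
  linarith

end CliqueFour

section Extremal

theorem L_eq_sum_prod {k : ℕ} (r : ℕ) (z : Fin k → ℝ) :
    L k r (fun i j => if i = j then 0 else 1) z =
      ∑ X ∈ Finset.powersetCard r (Finset.univ : Finset (Fin k)), ∏ i ∈ X, z i := by
  refine Finset.sum_congr rfl fun X _ => ?_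
  rw [Finset.prod_eq_one, one_mul]
  intro i _
  refine Finset.prod_eq_one fun j hj => ?_
  exact if_neg (Finset.mem_filter.1 hj).2.ne

theorem L_one_defect {k : ℕ} (p : Fin k) (r : ℕ) (x y : ℝ) :
    L k (r + 1) (fun i j => if i = j then 0 else 1) (fun i => if i = p then y else x) =
      ((k - 1).choose (r + 1) : ℝ) * x ^ (r + 1) + ((k - 1).choose r : ℝ) * x ^ r * y := by
  have hp : p ∉ Finset.univ.erase p := Finset.notMem_erase _ _
  have hcard : (Finset.univ.erase p).card = k - 1 := by
    rw [Finset.card_erase_of_mem (Finset.mem_univ p), Finset.card_univ, Fintype.card_fin]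
  have hprod : ∀ r, ∀ X ∈ Finset.powersetCard r (Finset.univ.erase p),
      ∏ i ∈ X, (if i = p then y else x) = x ^ r := by
    intro r X hX
    rw [Finset.mem_powersetCard] at hX
    rw [← hX.2, ← Finset.prod_const]
    exact Finset.prod_congr rfl fun i hi => if_neg (Finset.ne_of_mem_erase (hX.1 hi))
  have hsub : ∀ X ∈ Finset.powersetCard r (Finset.univ.erase p), p ∉ X := fun X hX h =>
    hp ((Finset.mem_powersetCard.1 hX).1 h)
  have hinsert : ∀ X ∈ Finset.powersetCard r (Finset.univ.erase p),
      ∏ i ∈ insert p X, (if i = p then y else x) = y * x ^ r := fun X hX => by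
    rw [Finset.prod_insert (hsub X hX), if_pos rfl, hprod r X hX]
  rw [L_eq_sum_prod, ← Finset.insert_erase (Finset.mem_univ p), Finset.powersetCard_succ_insert hp,
    Finset.sum_union (Finset.disjoint_left.2 fun X hX hX' => ?_),
    Finset.sum_congr rfl (hprod (r + 1)), Finset.sum_image, Finset.sum_congr rfl hinsert]
  · simp only [Finset.sum_const, Finset.card_powersetCard, hcard, nsmul_eq_mul]
    ring
  · intro X hX Y hY h
    rw [← Finset.erase_insert (hsub X hX), h, Finset.erase_insert (hsub Y hY)]
  · obtain ⟨Y, -, rfl⟩ := Finset.mem_image.1 hX'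
    exact hp ((Finset.mem_powersetCard.1 hX).1 (Finset.mem_insert_self p Y))

theorem cast_choose_succ_mul (n k : ℕ) (h : k ≤ n) :
    (n.choose (k + 1) : ℝ) * (k + 1) = n.choose k * (n - k) := by
  have := Nat.choose_succ_right_eq n k
  rw [← Nat.cast_sub h]
  exact_mod_cast this

theorem cast_choose_three (n : ℕ) (h : 2 ≤ n) :
    (n.choose 3 : ℝ) = n * (n - 1) * (n - 2) / 6 := by
  have h1 := cast_choose_succ_mul n 2 h
  rw [Nat.cast_choose_two] at h1
  push_cast at h1
  linarith

theorem cast_choose_four (n : ℕ) (h : 3 ≤ n) :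
    (n.choose 4 : ℝ) = n * (n - 1) * (n - 2) * (n - 3) / 24 := by
  have h1 := cast_choose_succ_mul n 3 h
  rw [cast_choose_three n (by omega)] at h1
  push_cast at h1
  linarith

variable {c : ℝ}

theorem xval_yval_spec (hc : c ∈ Set.Ioo (0 : ℝ) (1 / 2)) {t : ℕ} (ht : 1 ≤ t)
    (hs : xi c = t + 1) :
    1 / ((t : ℝ) + 1) ≤ xval c ∧ xval c ≤ 1 / (t : ℝ) ∧ yval c = 1 - t * xval c ∧
      edgePoly t (xval c) = c := by
  have ht0 : (0 : ℝ) < t := by exact_mod_cast ht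
  have hc2 : 0 < 1 - 2 * c := by linarith [hc.2]
  have hpos : 0 < 1 / (1 - 2 * c) := by positivity
  have h1 : 1 / (1 - 2 * c) ≤ (t : ℝ) + 1 := by
    have := Nat.le_ceil (1 / (1 - 2 * c))
    change _ ≤ (xi c : ℝ) at this
    rw [hs] at this
    exact_mod_cast this
  have h2 : (t : ℝ) + 1 < 1 / (1 - 2 * c) + 1 := by
    have := Nat.ceil_lt_add_one hpos.le
    change (xi c : ℝ) < _ at this
    rw [hs] at this
    exact_mod_cast this
  rw [div_le_iff₀ hc2] at h1
  have h2 : (t : ℝ) * (1 - 2 * c) < 1 := (lt_div_iff₀ hc2).1 (by linarith)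
  set ρ := sqc c with hρ
  have hu : 0 ≤ 1 - 2 * ((t : ℝ) + 1) * c / t := by
    rw [sub_nonneg, div_le_one ht0]; linarith
  have hρ0 : 0 ≤ ρ := Real.sqrt_nonneg _
  have hρ2 : t * ρ ^ 2 = t - 2 * (t + 1) * c := by
    rw [hρ, sqc, hs]
    push_cast
    rw [add_sub_cancel_right, Real.sq_sqrt hu]
    field_simp
  have hx : xval c = (1 + ρ) / (t + 1) := by
    rw [xval, hs, ← hρ]; push_cast; field_simp
  have hy : yval c = (1 - t * ρ) / (t + 1) := by
    rw [yval, hs, ← hρ]; push_cast; field_simp; ring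
  have hρ1 : t * ρ ≤ 1 := by
    refine le_of_sq_le_sq ?_ zero_le_one
    nlinarith
  refine ⟨?_, ?_, ?_, ?_⟩
  · rw [hx]; gcongr; linarith
  · rw [hx, div_le_div_iff₀ (by positivity) ht0]; linarith
  · rw [hx, hy]; field_simp; ring
  · rw [hx, edgePoly]
    field_simp
    linarith

theorem phiF_four_eq {t : ℕ} (ht : 3 ≤ t) (hs : xi c = t + 1) (hy : yval c = 1 - t * xval c) :
    phiF 4 c = (t : ℝ) * (t - 1) * (t - 2) / 6 * xval c ^ 3 -
      ((t : ℝ) + 1) * t * (t - 1) * (t - 2) / 8 * xval c ^ 4 := by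
  rw [phiF, hs, hy, Nat.add_sub_cancel, cast_choose_four t ht, cast_choose_three t (by omega)]
  ring

end Extremal

theorem phi_four_eq (c : ℝ) (hc : c ∈ Set.Ioo (0 : ℝ) (1 / 2)) (n : ℕ)
    (h4 : 4 ≤ xi c) (hxn : xi c ≤ n) :
    phi 4 n c = phiF 4 c := by
  obtain ⟨t, hs⟩ : ∃ t, xi c = t + 1 := ⟨xi c - 1, by omega⟩
  have ht : 3 ≤ t := by omega
  obtain ⟨hx1, hx2, hy, hedge⟩ := xval_yval_spec hc (by omega) hs
  have ht0 : (0 : ℝ) < t := by exact_mod_cast (by omega : 0 < t)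
  refine IsLeast.csInf_eq ⟨?_, ?_⟩
  · have hxi : 0 < xi c := by omega
    refine ⟨xi c, h4, hxn, fun i j => if i = j then 0 else 1,
      fun i => if i = ⟨0, hxi⟩ then yval c else xval c,
      ⟨fun i => if_pos rfl, fun i j => ?_, fun i j => ?_, fun i j => ?_, fun i => ?_, ?_, ?_⟩,
      L_one_defect _ 3 _ _⟩
    · dsimp only; split_ifs <;> norm_num
    · dsimp only; split_ifs <;> norm_num
    · simp only [eq_comm]
    · rw [le_div_iff₀ ht0] at hx2
      have := (by positivity : 0 ≤ 1 / ((t : ℝ) + 1)).trans hx1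
      dsimp only
      split_ifs
      · rw [hy]; linarith
      · exact this
    · rw [L_one_defect _ 0, hs, hy]
      simp
    · rw [L_one_defect _ 1, hs, hy, Nat.add_sub_cancel, Nat.cast_choose_two]
      refine Eq.trans ?_ hedge
      simp only [Nat.choose_one_right, edgePoly]
      ring
  · rintro v ⟨k, -, -, A, z, ⟨h1, h2, h3, h4, hz, hL1, hL2⟩, rfl⟩
    have hA : IsWeight A := ⟨h1, h2, h3, h4⟩
    rw [L_eq_cliqueForm hA, cliqueForm_one] at hL1
    rw [L_eq_cliqueForm hA] at hL2 ⊢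
    obtain ⟨m, rfl⟩ : ∃ m, t = m + 1 + 1 := ⟨t - 2, by omega⟩
    have hm : (1 : ℝ) ≤ m := by exact_mod_cast (by omega : 1 ≤ m)
    rw [phiF_four_eq ht hs hy]
    push_cast at hx1 hx2 hedge ⊢
    exact cliqueForm_four_ge (by linarith) (cliqueThreeBound (Fin k) m) hA hz hL1 hx1 hx2
      (hL2.trans hedge.symm)
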